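/- arXiv:2312.13163 — 2 statements merged into one kernel-verified Lean document; each statement's English description precedes it below -/
import Mathlib

section
/- Let 1 ≤ p ≤ 2. Assume the system D_N = {φ_j}_{j=1}^N is an orthonormal system in L_2(Ω,μ) that is uniformly bounded: ‖φ_j‖_∞ ≤ B for j = 1,…,N. Then D_N has the (v,N)-incoherence property in L_p(Ω,μ) with parameters V = C(B) (a constant depending only on B; in fact V = B^{1−2/p'} with p' = p/(p−1) works) and r = 1/p; that is, for any A ⊆ B' ⊆ {1,…,N} with |A| ≤ v and any complex coefficients {c_i}: Σ_{i∈A} |c_i| ≤ B^{1−2/p'} |A|^{1/p} ‖Σ_{i∈B'} c_i φ_i‖_p. -/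
open MeasureTheory Finset
open scoped ENNReal NNReal BigOperators

noncomputable section

attribute [local instance] Classical.propDecidable

namespace SamplingRecovery

/-- The `L_p(μ)` norm of a complex-valued function, `1 ≤ p < ∞`. -/
def lpNorm {X : Type*} [MeasurableSpace X] (μ : Measure X) (p : ℝ) (f : X → ℂ) : ℝ :=
  (∫ x, ‖f x‖ ^ p ∂μ) ^ (1 / p)

/-- The discrete `L_p(Ω_m, μ_m)` norm associated with sample points `ξ`. -/
def dNorm {X : Type*} {m : ℕ} (ξ : Fin m → X) (p : ℝ) (f : X → ℂ) : ℝ :=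
  ((m : ℝ)⁻¹ * ∑ j, ‖f (ξ j)‖ ^ p) ^ (1 / p)

/-- The uniform norm of a function. -/
def supNorm {X : Type*} (f : X → ℂ) : ℝ := ⨆ x, ‖f x‖

/-- `Σ_v(D)`: the set of all `v`-term linear combinations with respect to the system `g`. -/
def SigmaSet {X ι : Type*} (g : ι → X → ℂ) (v : ℕ) : Set (X → ℂ) :=
  {f | ∃ (B : Finset ι) (c : ι → ℂ), B.card ≤ v ∧ f = fun x => ∑ i ∈ B, c i * g i x}

/-- `Σ_v` restricted to indices in a finite set `T`. -/
def SigmaSetOn {X ι : Type*} (g : ι → X → ℂ) (T : Finset ι) (v : ℕ) : Set (X → ℂ) :=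
  {f | ∃ (B : Finset ι) (c : ι → ℂ), B ⊆ T ∧ B.card ≤ v ∧ f = fun x => ∑ i ∈ B, c i * g i x}

/-- `σ_v(f, D)_X`: the best `v`-term approximation error of `f` with respect to the
system `g`, measured in the (semi)norm `nrm`. -/
def sigmaErr {X ι : Type*} (nrm : (X → ℂ) → ℝ) (g : ι → X → ℂ) (v : ℕ) (f : X → ℂ) : ℝ :=
  sInf ((fun h => nrm (f - h)) '' SigmaSet g v)

/-- `σ_v(f, D)` with the system restricted to indices in `T`. -/
def sigmaErrOn {X ι : Type*} (nrm : (X → ℂ) → ℝ) (g : ι → X → ℂ) (T : Finset ι)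
    (v : ℕ) (f : X → ℂ) : ℝ :=
  sInf ((fun h => nrm (f - h)) '' SigmaSetOn g T v)

/-- The `(v,S)`-incoherence property with parameters `V > 0` and `r > 0` in the
(semi)norm `nrm`. -/
def Incoherent {X ι : Type*} (g : ι → X → ℂ) (v S : ℕ) (V r : ℝ)
    (nrm : (X → ℂ) → ℝ) : Prop :=
  ∀ (A B : Finset ι), A ⊆ B → A.card ≤ v → B.card ≤ S →
    ∀ c : ι → ℂ,
      ∑ i ∈ A, ‖c i‖ ≤ V * (A.card : ℝ) ^ r * nrm (fun x => ∑ i ∈ B, c i * g i x)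

/-- `(v,S)`-unconditionality with parameter `U` in the (semi)norm `nrm`. -/
def Unconditional {X ι : Type*} (g : ι → X → ℂ) (v S : ℕ) (U : ℝ)
    (nrm : (X → ℂ) → ℝ) : Prop :=
  ∀ (A B : Finset ι), A ⊆ B → A.card ≤ v → B.card ≤ S →
    ∀ c : ι → ℂ,
      nrm (fun x => ∑ i ∈ A, c i * g i x) ≤ U * nrm (fun x => ∑ i ∈ B, c i * g i x)

/-- The points `ξ` provide `L_p`-universal sampling discretization for the collection
`X_u(D_N)` of `u`-term subspaces generated by the system `g`. -/
def USD {X : Type*} [MeasurableSpace X] (μ : Measure X) (p : ℝ) {ι : Type*} {m : ℕ}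
    (g : ι → X → ℂ) (u : ℕ) (ξ : Fin m → X) : Prop :=
  ∀ f ∈ SigmaSet g u,
    (1 / 2 : ℝ) * (∫ x, ‖f x‖ ^ p ∂μ) ≤ (m : ℝ)⁻¹ * ∑ j, ‖f (ξ j)‖ ^ p ∧
    (m : ℝ)⁻¹ * ∑ j, ‖f (ξ j)‖ ^ p ≤ (3 / 2 : ℝ) * (∫ x, ‖f x‖ ^ p ∂μ)

/-- The measure `μ_ξ = (1/2) μ + (1/(2m)) ∑_j δ_{ξ^j}`. -/
def sampleMeasure {X : Type*} [MeasurableSpace X] (μ : Measure X) {m : ℕ}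
    (ξ : Fin m → X) : Measure X :=
  (1 / 2 : ℝ≥0∞) • μ + ((2 * m : ℝ≥0∞))⁻¹ • ∑ j, Measure.dirac (ξ j)

/-- A realization of the Weak Chebyshev Greedy Algorithm with weakness parameter `t`
applied to `f0` with respect to the system `g`, in the space with (semi)norm `nrm`:
`G k` is the approximant after `k` iterations (`f_k = f0 - G k` is the residual),
`φ k` the element of the system chosen at step `k+1`.  At each step a norming
functional `F` of the residual is used (a linear functional of norm `≤ 1` with
`F(f_k) = ‖f_k‖`), the new element `g (φ k)` satisfies the weakness condition
`|F(g (φ k))| ≥ t ⬝ sup_i |F(g i)|`, and `G (k+1)` is a best approximant to `f0`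
from the span of the chosen elements. -/
def IsWCGA {X ι : Type*} (g : ι → X → ℂ) (nrm : (X → ℂ) → ℝ) (t : ℝ)
    (f0 : X → ℂ) (φ : ℕ → ι) (G : ℕ → X → ℂ) : Prop :=
  G 0 = 0 ∧
  ∀ k : ℕ,
    (∃ F : (X → ℂ) →ₗ[ℂ] ℂ,
      (∀ h, ‖F h‖ ≤ nrm h) ∧
      F (f0 - G k) = ((nrm (f0 - G k) : ℝ) : ℂ) ∧
      ∀ i, t * ‖F (g i)‖ ≤ ‖F (g (φ k))‖) ∧
    G (k + 1) ∈ Submodule.span ℂ ((fun j => g (φ j)) '' Set.Iic k) ∧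
    ∀ h ∈ Submodule.span ℂ ((fun j => g (φ j)) '' Set.Iic k),
      nrm (f0 - G (k + 1)) ≤ nrm (f0 - h)

/-- The dyadic shell `{k ∈ ℤ^d : [2^{j-1}] ≤ ‖k‖_∞ < 2^j}` as a finite set. -/
def shell (d j : ℕ) : Finset (Fin d → ℤ) :=
  (Finset.Icc (fun _ => -(2 ^ j : ℤ)) fun _ => (2 ^ j : ℤ)).filter
    fun k => (if j = 0 then (0 : ℝ) else (2 : ℝ) ^ (j - 1)) ≤ ‖k‖ ∧ ‖k‖ < (2 : ℝ) ^ j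

/-- The discrete ball `{k ∈ ℤ^d : ‖k‖_∞ < n}` as a finite set. -/
def lball (d n : ℕ) : Finset (Fin d → ℤ) :=
  (Finset.Icc (fun _ => -(n : ℤ)) fun _ => (n : ℤ)).filter fun k => ‖k‖ < (n : ℝ)

/-- The class `A^r_β(Ψ)`: functions admitting an absolutely convergent expansion
`f = ∑_k a_k ψ_k` with `(∑_{[2^{j-1}] ≤ ‖k‖_∞ < 2^j} |a_k|^β)^{1/β} ≤ 2^{-rj}` for all `j`. -/
def ArClass {X : Type*} {d : ℕ} (ψ : (Fin d → ℤ) → X → ℂ) (β r : ℝ) : Set (X → ℂ) :=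
  {f | ∃ a : (Fin d → ℤ) → ℂ,
    Summable (fun k => ‖a k‖) ∧
    (∀ x, HasSum (fun k => a k * ψ k x) (f x)) ∧
    ∀ j : ℕ, (∑ k ∈ shell d j, ‖a k‖ ^ β) ^ (1 / β) ≤ (2 : ℝ) ^ (-(r * j))}

/-- `ϱ_m^o(F, X)`: the optimal sampling recovery error of a class `F` from `m` point
values, measured in the (semi)norm `nrm`; the recovery maps `M` are arbitrary. -/
def optRecovery {X : Type*} (F : Set (X → ℂ)) (m : ℕ) (nrm : (X → ℂ) → ℝ) : ℝ :=
  ⨅ (ξ : Fin m → X), ⨅ (M : (Fin m → ℂ) → X → ℂ),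
    ⨆ f ∈ F, nrm (f - M fun j => f (ξ j))

/-- The Kolmogorov width `d_n(F, E)` of a set `F` in a space with (semi)norm `nrm`. -/
def kWidth {E : Type*} [AddCommGroup E] [Module ℂ E] (nrm : E → ℝ) (F : Set E)
    (n : ℕ) : ℝ :=
  ⨅ u : Fin n → E, ⨆ f ∈ F, ⨅ c : Fin n → ℂ, nrm (f - ∑ i, c i • u i)

/-- Normalized Lebesgue measure on the cube `[0, 2π)^d`, representing `𝕋^d`. -/
def torusMeasure (d : ℕ) : Measure (Fin d → ℝ) :=
  (ENNReal.ofReal ((2 * Real.pi) ^ d))⁻¹ •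
    volume.restrict (Set.univ.pi fun _ => Set.Ico (0 : ℝ) (2 * Real.pi))

/-- The trigonometric monomial `e^{i(k,x)}` on `𝕋^d`. -/
def trig {d : ℕ} (k : Fin d → ℤ) (x : Fin d → ℝ) : ℂ :=
  Complex.exp (Complex.I * ((∑ j, (k j : ℝ) * x j : ℝ) : ℂ))

end SamplingRecovery

open SamplingRecovery

theorem pairing_aux {X : Type*} [TopologicalSpace X] [CompactSpace X] [MeasurableSpace X]
    [OpensMeasurableSpace X] (μ : Measure X) [IsFiniteMeasure μ] {N : ℕ}
    (g : Fin N → X → ℂ) (hg : ∀ i, Continuous (g i))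
    (hon : ∀ i j, ∫ x, g i x * (starRingEnd ℂ) (g j x) ∂μ = if i = j then 1 else 0)
    (A S : Finset (Fin N)) (hAS : A ⊆ S) (c e : Fin N → ℂ) :
    ∫ x, (∑ i ∈ S, c i * g i x) * (starRingEnd ℂ) (∑ i ∈ A, e i * g i x) ∂μ
      = ∑ i ∈ A, c i * (starRingEnd ℂ) (e i) := by
  have hint : ∀ i j, Integrable (fun x => (c i * (starRingEnd ℂ) (e j)) *
      (g i x * (starRingEnd ℂ) (g j x))) μ := by
    intro i j
    have hc : Continuous (fun x => (c i * (starRingEnd ℂ) (e j)) *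
      (g i x * (starRingEnd ℂ) (g j x))) :=
      continuous_const.mul ((hg i).mul (Complex.continuous_conj.comp (hg j)))
    exact hc.integrable_of_hasCompactSupport (HasCompactSupport.of_compactSpace _)
  have h1 : ∀ x, (∑ i ∈ S, c i * g i x) * (starRingEnd ℂ) (∑ i ∈ A, e i * g i x)
      = ∑ j ∈ A, ∑ i ∈ S, (c i * (starRingEnd ℂ) (e j)) *
      (g i x * (starRingEnd ℂ) (g j x)) := by
    intro x
    rw [map_sum, Finset.sum_mul_sum, Finset.sum_comm]
    refine Finset.sum_congr rfl fun j _ => Finset.sum_congr rfl fun i _ => ?_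
    rw [map_mul]; ring
  simp_rw [h1]
  rw [integral_finsetSum _ (fun j _ => integrable_finsetSum _ (fun i _ => hint i j))]
  refine Finset.sum_congr rfl fun j hj => ?_
  rw [integral_finsetSum _ (fun i _ => hint i j)]
  simp_rw [integral_const_mul, hon]
  simp [hAS hj]

theorem holder_aux {X : Type*} [TopologicalSpace X] [CompactSpace X] [MeasurableSpace X]
    [OpensMeasurableSpace X] (μ : Measure X) [IsFiniteMeasure μ]
    (p : ℝ) (hp1 : 1 ≤ p) (hp2 : p ≤ 2) (f h : X → ℂ) (hf : Continuous f) (hh : Continuous h)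
    (B n : ℝ) (hB : 0 < B) (hn : 0 < n) (hbd : ∀ x, ‖h x‖ ≤ n * B)
    (hL2 : ∫ x, ‖h x‖ ^ (2 : ℝ) ∂μ ≤ n) :
    ∫ x, ‖f x‖ * ‖h x‖ ∂μ ≤ B ^ (1 - 2 / (p / (p - 1))) * n ^ (1 / p) * lpNorm μ p f := by
  have hI : ∀ u : X → ℝ, Continuous u → Integrable u μ := fun u hu =>
    hu.integrable_of_hasCompactSupport (HasCompactSupport.of_compactSpace _)
  rcases hp1.eq_or_lt with rfl | hp
  · simp only [SamplingRecovery.lpNorm, sub_self, div_zero, sub_zero, Real.rpow_one, div_one]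
    rw [← integral_const_mul]
    refine integral_mono (hI _ (by fun_prop)) (hI _ (by fun_prop)) fun x => ?_
    have := mul_le_mul_of_nonneg_left (hbd x) (norm_nonneg (f x))
    simp only
    linarith
  · have hp0 : 0 < p := by linarith
    have hpm : 0 < p - 1 := by linarith
    set q := p / (p - 1) with hq
    have hq2 : 2 ≤ q := by rw [hq, le_div_iff₀ hpm]; linarith
    have hq0 : 0 < q := by linarith
    have hpq : p.HolderConjugate q := Real.HolderConjugate.conjExponent hp
    have hM : ∀ (u : X → ℂ) (r : ℝ), Continuous u →  MemLp u (ENNReal.ofReal r) μ := by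
      intro u r hu
      exact hu.memLp_of_hasCompactSupport (HasCompactSupport.of_compactSpace _)
    have H := integral_mul_norm_le_Lp_mul_Lq hpq (hM f p hf) (hM h q hh)
    have hnB : 0 < n * B := by positivity
    have hq' : ∫ x, ‖h x‖ ^ q ∂μ ≤ (n * B) ^ (q - 2) * n := by
      calc ∫ x, ‖h x‖ ^ q ∂μ ≤ ∫ x, (n * B) ^ (q - 2) * ‖h x‖ ^ (2 : ℝ) ∂μ := by
            refine integral_mono (hI _ (hh.norm.rpow_const fun _ => Or.inr hq0.le))
              (hI _ (continuous_const.mul (hh.norm.rpow_const fun _ => Or.inr (by norm_num)))) ?_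
            intro x
            have e : ‖h x‖ ^ q = ‖h x‖ ^ (q - 2) * ‖h x‖ ^ (2 : ℝ) := by
              rw [← Real.rpow_add_of_nonneg (norm_nonneg _) (by linarith) (by norm_num)]
              congr 1; ring
            simp only
            rw [e]
            exact mul_le_mul_of_nonneg_right
              (Real.rpow_le_rpow (norm_nonneg _) (hbd x) (by linarith)) (by positivity)
        _ ≤ _ := by
            rw [integral_const_mul]
            exact mul_le_mul_of_nonneg_left hL2 (by positivity)
    have hq'' : (∫ x, ‖h x‖ ^ q ∂μ) ^ (1 / q) ≤ B ^ (1 - 2 / q) * n ^ (1 / p) := by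
      refine (Real.rpow_le_rpow (integral_nonneg fun x => by positivity) hq'
        (by positivity)).trans_eq ?_
      rw [Real.mul_rpow (by positivity) hn.le, ← Real.rpow_mul hnB.le,
        Real.mul_rpow hn.le hB.le, mul_right_comm, ← Real.rpow_add hn, mul_comm]
      congr 2
      · field_simp
      · rw [hq]; field_simp; ring
    calc _ ≤ _ := H
      _ ≤ lpNorm μ p f * (B ^ (1 - 2 / q) * n ^ (1 / p)) :=
          mul_le_mul_of_nonneg_left hq''
            (Real.rpow_nonneg (integral_nonneg fun x => by positivity) _)
      _ = _ := mul_comm _ _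

/-- a uniformly bounded (`‖φ_j‖_∞ ≤ B`) orthonormal system has, for
`1 ≤ p ≤ 2`, the `(v,N)`-incoherence property in `L_p(Ω,μ)` with parameters
`V = B^{1-2/p'}` (where `p' = p/(p-1)`) and `r = 1/p`. -/
theorem orthonormal_system_incoherent
    {d : ℕ} (p : ℝ) (hp1 : 1 ≤ p) (hp2 : p ≤ 2)
    (Ω : Set (Fin d → ℝ)) (hΩ : IsCompact Ω)
    (μ : Measure Ω) (hμ : IsProbabilityMeasure μ)
    (N v : ℕ) (B : ℝ) (hB : 0 < B)
    (g : Fin N → Ω → ℂ) (hg : ∀ i, Continuous (g i))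
    (hbd : ∀ i x, ‖g i x‖ ≤ B)
    (hon : ∀ i j, ∫ x, g i x * (starRingEnd ℂ) (g j x) ∂μ = if i = j then 1 else 0) :
    Incoherent g v N (B ^ (1 - 2 / (p / (p - 1)))) (1 / p) (lpNorm μ p) := by
  have : CompactSpace Ω := isCompact_iff_compactSpace.mp hΩ
  intro A S hAS _ _ c
  rcases A.eq_empty_or_nonempty with rfl | hA
  · simp only [Finset.sum_empty]
    exact mul_nonneg (by positivity)
      (Real.rpow_nonneg (integral_nonneg fun x => by positivity) _)
  have hn : (0 : ℝ) < (A.card : ℝ) := by exact_mod_cast hA.card_pos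
  have he : ∀ z : ℂ, ∃ w : ℂ, ‖w‖ = 1 ∧ z * (starRingEnd ℂ) w = (‖z‖ : ℂ) := by
    intro z
    refine ⟨Complex.exp (z.arg * Complex.I), Complex.norm_exp_ofReal_mul_I _, ?_⟩
    nth_rewrite 1 [← Complex.norm_mul_exp_arg_mul_I z]
    rw [mul_assoc, Complex.mul_conj, Complex.normSq_eq_norm_sq, Complex.norm_exp_ofReal_mul_I]
    simp
  choose w hw1 hw2 using he
  set f : Ω → ℂ := fun x => ∑ i ∈ S, c i * g i x with hf
  set h : Ω → ℂ := fun x => ∑ i ∈ A, w (c i) * g i x with hh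
  have hfc : Continuous f := continuous_finsetSum _ fun i _ => continuous_const.mul (hg i)
  have hhc : Continuous h := continuous_finsetSum _ fun i _ => continuous_const.mul (hg i)
  have P1 := pairing_aux μ g hg hon A S hAS c (fun i => w (c i))
  have P2 := pairing_aux μ g hg hon A A subset_rfl (fun i => w (c i)) (fun i => w (c i))
  have hL2 : ∫ x, ‖h x‖ ^ (2 : ℝ) ∂μ ≤ (A.card : ℝ) := by
    apply le_of_eq
    have : ∀ x, (∑ i ∈ A, w (c i) * g i x) * (starRingEnd ℂ) (∑ i ∈ A, w (c i) * g i x)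
        = ((‖h x‖ ^ (2 : ℝ) : ℝ) : ℂ) := by
      intro x
      rw [Complex.mul_conj, Complex.normSq_eq_norm_sq, Real.rpow_two]
    simp_rw [this] at P2
    rw [integral_complex_ofReal] at P2
    simp_rw [Complex.mul_conj, Complex.normSq_eq_norm_sq, hw1] at P2
    simp only [one_pow, Complex.ofReal_one, Finset.sum_const, nsmul_eq_mul, mul_one] at P2
    exact_mod_cast P2
  have hb : ∀ x, ‖h x‖ ≤ (A.card : ℝ) * B := by
    intro x
    rw [← nsmul_eq_mul]
    refine norm_sum_le_of_le _ (fun i _ => ?_) |>.trans_eq (Finset.sum_const B)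
    rw [norm_mul, hw1, one_mul]
    exact hbd i x
  refine le_trans ?_ (holder_aux μ p hp1 hp2 f h hfc hhc B A.card hB hn hb hL2)
  have e : ∑ i ∈ A, ‖c i‖ = ‖∫ x, f x * (starRingEnd ℂ) (h x) ∂μ‖ := by
    simp only [hf, hh]
    rw [P1]
    simp_rw [hw2]
    rw [← Complex.ofReal_sum, Complex.norm_real, Real.norm_of_nonneg (by positivity)]
  rw [e]
  refine (norm_integral_le_integral_norm _).trans_eq ?_
  simp
end
end

section
/- Assume D_N = {φ_j}_{j=1}^N ⊂ C(Ω) is a uniformly bounded Riesz system: sup_{x∈Ω}|φ_j(x)| ≤ 1 for all j, and R_1 (Σ|a_j|²)^{1/2} ≤ ‖Σ a_j φ_j‖_2 ≤ R_2 (Σ|a_j|²)^{1/2} for all complex (a_1,…,a_N) with 0 < R_1 ≤ R_2 < ∞. Let 2 < p < ∞ and t ∈ (0,1]. Then there are constants V = R_1^{−1}, c = C(t,p) ≥ 1 (depending only on t and p), and C = C(p,R_1,R_2) with the following property: for any positive integer v with u := ⌈(1 + c(2V)²(ln(2Vv))) v⌉ ≤ N there exist m points ξ^1,…,ξ^m ∈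 Ω with m ≤ C u^{p/2} (log N)² such that for any f_0 ∈ C(Ω), the WCGA with weakness parameter t applied to f_0 with respect to D_N(Ω_m) in L_p(Ω_m,μ_m) gives ‖f_u‖_{L_p(Ω_m,μ_m)} ≤ C_0 σ_v(f_0, D_N(Ω_m))_{L_p(Ω_m,μ_m)} and ‖f_u‖_{L_p(Ω,μ)} ≤ C_0 σ_v(f_0, D_N)_∞, where C_0 ≥ 1 is an absolute constant. -/
open MeasureTheory Finset
open scoped ENNReal NNReal BigOperators

noncomputable section

attribute [local instance] Classical.propDecidable

open SamplingRecovery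

/-- Number of iterations `u = ⌈(1 + c (2V)² ln(2Vv)) v⌉` with `V = R₁⁻¹`. -/
def uRiesz (c R1 : ℝ) (v : ℕ) : ℕ :=
  ⌈(1 + c * (2 * R1⁻¹) ^ 2 * Real.log (2 * R1⁻¹ * v)) * (v : ℝ)⌉₊


/-! ### Part 1: the abstract WCGA inequality -/

theorem wc_decrease {X : Type*} (q : Seminorm ℂ (X → ℂ)) (γ : ℝ) (hγ : 0 ≤ γ)
    (hs : ∀ x y, 0 < q x → q (x + y) + q (x - y) ≤ 2 * q x + 2 * γ * (q y) ^ 2 / q x)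
    (F : (X → ℂ) →ₗ[ℂ] ℂ) (hF : ∀ h, ‖F h‖ ≤ q h) (f w : X → ℂ)
    (hf : F f = ((q f : ℝ) : ℂ)) (hpos : 0 < q f) (l : ℝ) (hl : 0 ≤ l) :
    ∃ z : ℂ, q (f - z • w) ≤ q f - l * ‖F w‖ + 2 * γ * (l * q w) ^ 2 / q f := by
  by_cases h0 : F w = 0
  · refine ⟨0, ?_⟩
    have : 0 ≤ 2 * γ * (l * q w) ^ 2 / q f := by positivity
    simp [h0]; linarith
  · have hn : 0 < ‖F w‖ := norm_pos_iff.mpr h0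
    set z : ℂ := (l : ℂ) * (starRingEnd ℂ (F w)) / (‖F w‖ : ℂ) with hz
    have hzF : z * F w = ((l * ‖F w‖ : ℝ) : ℂ) := by
      have hc : (‖F w‖ : ℂ) ≠ 0 := by exact_mod_cast hn.ne'
      have h1 : (starRingEnd ℂ (F w)) * F w = (‖F w‖ : ℂ) ^ 2 := Complex.conj_mul' _
      rw [hz]; push_cast; field_simp; linear_combination (l:ℂ) * h1
    have hzn : ‖z‖ = l := by
      rw [hz]; simp [abs_of_nonneg hl]; field_simp
    refine ⟨z, ?_⟩
    have h1 := hs f (z • w) hpos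
    have h2 : q f + l * ‖F w‖ ≤ q (f + z • w) := by
      have h3 := hF (f + z • w)
      have h4 : F (f + z • w) = ((q f + l * ‖F w‖ : ℝ) : ℂ) := by
        rw [map_add, map_smul, smul_eq_mul, hzF, hf]; push_cast; ring
      rw [h4, Complex.norm_real, Real.norm_eq_abs, abs_of_nonneg (by positivity)] at h3
      exact h3
    have h5 : q (z • w) = l * q w := by rw [map_smul_eq_mul, hzn]
    rw [h5] at h1
    linarith

theorem wc_vanish {X : Type*} (q : Seminorm ℂ (X → ℂ)) (γ : ℝ) (hγ : 0 ≤ γ)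
    (hs : ∀ x y, 0 < q x → q (x + y) + q (x - y) ≤ 2 * q x + 2 * γ * (q y) ^ 2 / q x)
    (F : (X → ℂ) →ₗ[ℂ] ℂ) (hF : ∀ h, ‖F h‖ ≤ q h) (f w : X → ℂ)
    (hf : F f = ((q f : ℝ) : ℂ)) (hpos : 0 < q f)
    (hb : ∀ z : ℂ, q f ≤ q (f - z • w)) : F w = 0 := by
  by_contra h0
  have hn : 0 < ‖F w‖ := norm_pos_iff.mpr h0
  set D := 2 * γ * (q w) ^ 2 / q f with hD
  have hD0 : 0 ≤ D := by positivity
  have hl : 0 < ‖F w‖ / (2 * (D + 1)) := by positivity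
  obtain ⟨z, hz⟩ := wc_decrease q γ hγ hs F hF f w hf hpos (‖F w‖ / (2 * (D + 1))) hl.le
  have h1 := hb z
  set l := ‖F w‖ / (2 * (D + 1)) with hld
  have h2 : 2 * γ * (l * q w) ^ 2 / q f = l * (l * D) := by rw [hD]; ring
  rw [h2] at hz
  have h3 : l * D < ‖F w‖ := by
    have : l * (2 * (D + 1)) = ‖F w‖ := by rw [hld]; field_simp
    nlinarith
  nlinarith

/-- The set of indices chosen during the first `m` steps. -/
def wcT {ι : Type*} (φ : ℕ → ι) (m : ℕ) : Finset ι := (Finset.range m).image φ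

theorem wcT_mono {ι : Type*} (φ : ℕ → ι) {m n : ℕ} (h : m ≤ n) : wcT φ m ⊆ wcT φ n :=
  Finset.image_subset_image (Finset.range_mono h)

theorem wcT_card {ι : Type*} (φ : ℕ → ι) (m : ℕ) : (wcT φ m).card ≤ m :=
  Finset.card_image_le.trans (by simp)

theorem wcT_span {X ι : Type*} (g : ι → X → ℂ) (φ : ℕ → ι) (k : ℕ) :
    ((fun j => g (φ j)) '' Set.Iic k) = g '' (wcT φ (k + 1) : Set ι) := by
  ext y
  simp only [wcT, Set.mem_image, Set.mem_Iic, Finset.coe_image, Finset.coe_range, Set.mem_Iio,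
    Nat.lt_succ_iff]
  constructor
  · rintro ⟨j, hj, rfl⟩; exact ⟨φ j, ⟨j, hj, rfl⟩, rfl⟩
  · rintro ⟨i, ⟨j, hj, rfl⟩, rfl⟩; exact ⟨j, hj, rfl⟩

theorem wc_best {X ι : Type*} (g : ι → X → ℂ) (nrm : (X → ℂ) → ℝ) (t : ℝ)
    (f0 : X → ℂ) (φ : ℕ → ι) (G : ℕ → X → ℂ) (h : IsWCGA g nrm t f0 φ G) (m : ℕ) :
    G m ∈ Submodule.span ℂ (g '' (wcT φ m : Set ι)) ∧
    ∀ w ∈ Submodule.span ℂ (g '' (wcT φ m : Set ι)), nrm (f0 - G m) ≤ nrm (f0 - w) := by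
  cases m with
  | zero =>
    simp [wcT, h.1]
  | succ k =>
    have := (h.2 k).2
    rw [wcT_span] at this
    exact this

theorem wc_mono {X ι : Type*} (g : ι → X → ℂ) (nrm : (X → ℂ) → ℝ) (t : ℝ)
    (f0 : X → ℂ) (φ : ℕ → ι) (G : ℕ → X → ℂ) (h : IsWCGA g nrm t f0 φ G) {m n : ℕ}
    (hmn : m ≤ n) : nrm (f0 - G n) ≤ nrm (f0 - G m) := by
  apply (wc_best g nrm t f0 φ G h n).2
  refine Submodule.span_mono ?_ (wc_best g nrm t f0 φ G h m).1
  exact Set.image_mono (by exact_mod_cast wcT_mono φ hmn)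

/-- `ℓ²` norm of coefficients on a finite set -/
def l2 {ι : Type*} (x : ι → ℂ) (A : Finset ι) : ℝ := Real.sqrt (∑ i ∈ A, ‖x i‖ ^ 2)

theorem l2_nonneg {ι : Type*} (x : ι → ℂ) (A : Finset ι) : 0 ≤ l2 x A := Real.sqrt_nonneg _

theorem l2_mono {ι : Type*} (x : ι → ℂ) {A B : Finset ι} (h : A ⊆ B) : l2 x A ≤ l2 x B :=
  Real.sqrt_le_sqrt (Finset.sum_le_sum_of_subset_of_nonneg h (fun _ _ _ => by positivity))

theorem l1_le_l2 {ι : Type*} (x : ι → ℂ) (A : Finset ι) (a : ℝ) (ha : (A.card : ℝ) ≤ a) :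
    ∑ i ∈ A, ‖x i‖ ≤ Real.sqrt a * l2 x A := by
  have h1 : (∑ i ∈ A, ‖x i‖) ^ 2 ≤ A.card * ∑ i ∈ A, ‖x i‖ ^ 2 := sq_sum_le_card_mul_sum_sq
  have h0 : 0 ≤ ∑ i ∈ A, ‖x i‖ ^ 2 := Finset.sum_nonneg (fun _ _ => by positivity)
  have ha0 : 0 ≤ a := le_trans (by positivity) ha
  rw [l2, ← Real.sqrt_mul ha0]
  apply Real.le_sqrt_of_sq_le
  exact h1.trans (mul_le_mul_of_nonneg_right ha h0)

/-- Hypotheses of the abstract WCGA theorem. -/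
structure WC {X ι : Type*} (q : Seminorm ℂ (X → ℂ)) (g : ι → X → ℂ) (t γ V : ℝ)
    (f0 : X → ℂ) (φ : ℕ → ι) (G : ℕ → X → ℂ) (T : Finset ι) (x : ι → ℂ) (v S : ℕ) (ε : ℝ) :
    Prop where
  hγ : 0 < γ
  hs : ∀ x y, 0 < q x → q (x + y) + q (x - y) ≤ 2 * q x + 2 * γ * (q y) ^ 2 / q x
  hg : ∀ i, q (g i) ≤ 1
  ht : 0 < t
  hV : 1 ≤ V
  hw : IsWCGA g q t f0 φ G
  hT : T.card ≤ v
  hv : 0 < v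
  hε : ε = q (f0 - ∑ i ∈ T, x i • g i)
  hinc : ∀ (B : Finset ι) (c : ι → ℂ), B.card ≤ S → l2 c B ≤ V * q (∑ i ∈ B, c i • g i)

section
variable {X ι : Type*} {q : Seminorm ℂ (X → ℂ)} {g : ι → X → ℂ} {t γ V : ℝ}
    {f0 : X → ℂ} {φ : ℕ → ι} {G : ℕ → X → ℂ} {T : Finset ι} {x : ι → ℂ} {v S : ℕ} {ε : ℝ}

theorem WC.eps_nonneg (H : WC q g t γ V f0 φ G T x v S ε) : 0 ≤ ε := by
  rw [H.hε]; exact apply_nonneg _ _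

/-- Coefficients outside the chosen set are controlled by the residual. -/
theorem WC.coef (H : WC q g t γ V f0 φ G T x v S ε) (m : ℕ) (hm : m + v ≤ S) :
    l2 x (T \ wcT φ m) ≤ V * (q (f0 - G m) + ε) := by
  have hG := (wc_best g q t f0 φ G H.hw m).1
  rw [Submodule.mem_span_image_finset_iff_exists_fun'] at hG
  obtain ⟨c, hc⟩ := hG
  set d : ι → ℂ := fun i => (if i ∈ T then x i else 0) - (if i ∈ wcT φ m then c i else 0) with hd
  have hsum : ∑ i ∈ T ∪ wcT φ m, d i • g i = (∑ i ∈ T, x i • g i) - G m := by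
    rw [← hc]
    simp only [hd, sub_smul, Finset.sum_sub_distrib, ite_smul, zero_smul]
    congr 1
    · rw [← Finset.sum_filter]; congr 1; ext i; simp +contextual
    · rw [← Finset.sum_filter]; congr 1; ext i; simp +contextual
  have hcard : (T ∪ wcT φ m).card ≤ S :=
    (Finset.card_union_le _ _).trans (by have := H.hT; have := wcT_card φ m; omega)
  have h1 := H.hinc _ d hcard
  rw [hsum] at h1
  have h2 : l2 x (T \ wcT φ m) = l2 d (T \ wcT φ m) := by
    unfold l2; congr 1
    refine Finset.sum_congr rfl (fun i hi => ?_)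
    rw [Finset.mem_sdiff] at hi
    simp [hd, hi.1, hi.2]
  have h3 : l2 d (T \ wcT φ m) ≤ l2 d (T ∪ wcT φ m) :=
    l2_mono d (Finset.sdiff_subset.trans Finset.subset_union_left)
  have h4 : q ((∑ i ∈ T, x i • g i) - G m) ≤ q (f0 - G m) + ε := by
    have : (∑ i ∈ T, x i • g i) - G m = (f0 - G m) - (f0 - ∑ i ∈ T, x i • g i) := by abel
    rw [this, H.hε]; exact map_sub_le_add q _ _
  have hV : 0 ≤ V := by linarith [H.hV]
  rw [h2]
  exact h3.trans (h1.trans (mul_le_mul_of_nonneg_left h4 hV))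

theorem WC.sum_le (H : WC q g t γ V f0 φ G T x v S ε) (A : Finset ι) :
    q (∑ i ∈ A, x i • g i) ≤ ∑ i ∈ A, ‖x i‖ := by
  refine (Finset.le_sum_of_subadditive q (map_zero q).le (map_add_le_add q) A _).trans
    (Finset.sum_le_sum fun i _ => ?_)
  rw [map_smul_eq_mul]
  exact mul_le_of_le_one_right (norm_nonneg _) (H.hg i)

theorem WC.split (m : ℕ) :
    ∑ i ∈ T, x i • g i = ∑ i ∈ T \ wcT φ m, x i • g i + ∑ i ∈ T ∩ wcT φ m, x i • g i := by
  rw [add_comm, ← Finset.sum_inter_add_sum_sdiff T (wcT φ m)]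

theorem WC.inter_mem (m : ℕ) :
    ∑ i ∈ T ∩ wcT φ m, x i • g i ∈ Submodule.span ℂ (g '' (wcT φ m : Set ι)) := by
  refine Submodule.sum_mem _ (fun i hi => Submodule.smul_mem _ _ (Submodule.subset_span ?_))
  exact ⟨i, by simpa using (Finset.mem_inter.mp hi).2, rfl⟩

theorem WC.upper (H : WC q g t γ V f0 φ G T x v S ε) (m : ℕ) :
    q (f0 - G m) ≤ ε + Real.sqrt v * l2 x (T \ wcT φ m) := by
  have h1 := (wc_best g q t f0 φ G H.hw m).2 _ (WC.inter_mem (T := T) (x := x) (g := g) m)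
  refine h1.trans ?_
  have : f0 - ∑ i ∈ T ∩ wcT φ m, x i • g i
      = (f0 - ∑ i ∈ T, x i • g i) + ∑ i ∈ T \ wcT φ m, x i • g i := by
    rw [WC.split (T := T) (x := x) (g := g) (φ := φ) m]; abel
  rw [this, H.hε]
  refine (map_add_le_add q _ _).trans (add_le_add le_rfl ((H.sum_le _).trans ?_))
  apply l1_le_l2
  exact_mod_cast (Finset.card_le_card Finset.sdiff_subset).trans H.hT

/-- one step -/
theorem WC.step (H : WC q g t γ V f0 φ G T x v S ε) (m : ℕ) (hm : m + v ≤ S)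
    (A : Finset ι) (a b : ℝ) (ha : 0 < a) (hA : (A.card : ℝ) ≤ a)
    (hb : l2 x ((T \ wcT φ m) \ A) ≤ b)
    (hr : 2 * (ε + Real.sqrt v * b) < q (f0 - G m)) :
    q (f0 - G (m + 1)) ≤ q (f0 - G m) * (1 - t ^ 2 / (72 * γ * V ^ 2) / a) := by
  obtain ⟨⟨F, hF, hFf, hFt⟩, -, hbest⟩ := H.hw.2 m
  set r := q (f0 - G m) with hrdef
  set Γ := T \ wcT φ m with hΓ
  have hε := H.eps_nonneg
  have hγ := H.hγ
  have ht := H.ht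
  have hV : 0 < V := by linarith [H.hV]
  have hb0 : 0 ≤ b := (l2_nonneg _ _).trans hb
  have hvb : 0 ≤ Real.sqrt v * b := by positivity
  have hr0 : 0 < r := by linarith
  obtain ⟨hGm, hGb⟩ := wc_best g q t f0 φ G H.hw m
  have hvan : ∀ w ∈ Submodule.span ℂ (g '' (wcT φ m : Set ι)), F w = 0 := by
    intro w hw
    apply wc_vanish q γ hγ.le H.hs F hF (f0 - G m) w hFf hr0
    intro z
    have := hGb (G m + z • w) (Submodule.add_mem _ hGm (Submodule.smul_mem _ _ hw))
    rwa [← sub_sub] at this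
  have hM : ∀ i, ‖F (g i)‖ ≤ ‖F (g (φ m))‖ / t := by
    intro i; rw [le_div_iff₀ ht]; linarith [hFt i]
  set M := ‖F (g (φ m))‖ with hMdef
  have hdec : f0 - G m = (f0 - ∑ i ∈ T, x i • g i) + (∑ i ∈ Γ ∩ A, x i • g i)
      + (∑ i ∈ Γ \ A, x i • g i) + (∑ i ∈ T ∩ wcT φ m, x i • g i - G m) := by
    have h1 := WC.split (T := T) (x := x) (g := g) (φ := φ) m
    have h2 := Finset.sum_inter_add_sum_sdiff Γ A (fun i => x i • g i)
    rw [h1, ← h2]; abel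
  have hFdec : F (f0 - G m) = F (f0 - ∑ i ∈ T, x i • g i) + F (∑ i ∈ Γ ∩ A, x i • g i)
      + F (∑ i ∈ Γ \ A, x i • g i) := by
    conv_lhs => rw [hdec]
    rw [map_add, hvan _ (Submodule.sub_mem _ (WC.inter_mem m) hGm), map_add, map_add, add_zero]
  have hcoef := H.coef m hm
  have hsqa : 0 < Real.sqrt a := Real.sqrt_pos.mpr ha
  have h1 : ‖F (∑ i ∈ Γ ∩ A, x i • g i)‖ ≤ Real.sqrt a * (V * (r + ε)) * (M / t) := by
    rw [map_sum]
    refine (norm_sum_le _ _).trans ?_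
    calc ∑ i ∈ Γ ∩ A, ‖F (x i • g i)‖ ≤ ∑ i ∈ Γ ∩ A, ‖x i‖ * (M / t) := by
          refine Finset.sum_le_sum fun i _ => ?_
          rw [map_smul, norm_smul]
          exact mul_le_mul_of_nonneg_left (hM i) (norm_nonneg _)
      _ = (∑ i ∈ Γ ∩ A, ‖x i‖) * (M / t) := by rw [Finset.sum_mul]
      _ ≤ _ := by
          refine mul_le_mul_of_nonneg_right ?_ (by positivity)
          refine (l1_le_l2 x (Γ ∩ A) a ?_).trans ?_
          · refine le_trans ?_ hA
            exact_mod_cast Finset.card_le_card Finset.inter_subset_right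
          · refine mul_le_mul_of_nonneg_left ?_ hsqa.le
            exact (l2_mono x Finset.inter_subset_left).trans hcoef
  have h2 : ‖F (∑ i ∈ Γ \ A, x i • g i)‖ ≤ Real.sqrt v * b := by
    refine (hF _).trans ((H.sum_le _).trans ?_)
    refine (l1_le_l2 x _ v ?_).trans (mul_le_mul_of_nonneg_left hb (Real.sqrt_nonneg _))
    exact_mod_cast (Finset.card_le_card (Finset.sdiff_subset.trans Finset.sdiff_subset)).trans H.hT
  have h3 : ‖F (f0 - ∑ i ∈ T, x i • g i)‖ ≤ ε := by rw [H.hε]; exact hF _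
  have h4 : r ≤ ε + Real.sqrt a * (V * (r + ε)) * (M / t) + Real.sqrt v * b := by
    have h5 : ‖F (f0 - G m)‖ = r := by
      rw [hFf, Complex.norm_real, Real.norm_eq_abs, abs_of_nonneg hr0.le]
    have h6 : r ≤ ‖F (f0 - ∑ i ∈ T, x i • g i)‖ + ‖F (∑ i ∈ Γ ∩ A, x i • g i)‖
        + ‖F (∑ i ∈ Γ \ A, x i • g i)‖ := by
      rw [← h5, hFdec]
      exact norm_add₃_le
    linarith
  have hM0 : 0 ≤ M := norm_nonneg _
  have h5 : t / (3 * Real.sqrt a * V) ≤ M := by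
    have h6 : Real.sqrt a * (V * (r + ε)) * (M / t) ≤ Real.sqrt a * (V * (3 / 2 * r)) * (M / t) := by
      have : r + ε ≤ 3 / 2 * r := by linarith
      gcongr
    have h7 : r / 2 ≤ Real.sqrt a * (V * (3 / 2 * r)) * (M / t) := by linarith
    rw [div_le_iff₀ (by positivity)]
    have h8 : Real.sqrt a * (V * (3 / 2 * r)) * (M / t) = r / 2 * ((M * (3 * Real.sqrt a * V)) / t) := by
      ring
    rw [h8] at h7
    have h9 : 1 ≤ (M * (3 * Real.sqrt a * V)) / t := by
      by_contra hcon
      push Not at hcon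
      nlinarith
    rwa [le_div_iff₀ ht, one_mul] at h9
  set θ := t / (3 * Real.sqrt a * V) with hθ
  have hθ0 : 0 < θ := by positivity
  obtain ⟨z, hz⟩ := wc_decrease q γ hγ.le H.hs F hF (f0 - G m) (g (φ m)) hFf hr0
    (r * θ / (4 * γ)) (by positivity)
  have hmem : G m + z • g (φ m) ∈ Submodule.span ℂ ((fun j => g (φ j)) '' Set.Iic m) := by
    rw [wcT_span]
    refine Submodule.add_mem _ ?_ (Submodule.smul_mem _ _ (Submodule.subset_span ?_))
    · exact Submodule.span_mono (Set.image_mono (by exact_mod_cast wcT_mono φ (Nat.le_succ m))) hGm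
    · exact ⟨φ m, by simp [wcT]; exact ⟨m, le_rfl, rfl⟩, rfl⟩
  have h10 := hbest _ hmem
  rw [← sub_sub] at h10
  refine h10.trans (hz.trans ?_)
  have h11 : (r * θ / (4 * γ) * q (g (φ m))) ^ 2 ≤ (r * θ / (4 * γ)) ^ 2 := by
    have := H.hg (φ m)
    have h12 : 0 ≤ r * θ / (4 * γ) := by positivity
    exact pow_le_pow_left₀ (by have := apply_nonneg q (g (φ m)); positivity)
      (mul_le_of_le_one_right h12 this) 2
  have h12 : r * θ / (4 * γ) * θ ≤ r * θ / (4 * γ) * M :=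
    mul_le_mul_of_nonneg_left h5 (by positivity)
  have h13 : 2 * γ * (r * θ / (4 * γ) * q (g (φ m))) ^ 2 / r
      ≤ 2 * γ * (r * θ / (4 * γ)) ^ 2 / r := by gcongr
  have h14 : 2 * γ * (r * θ / (4 * γ)) ^ 2 / r = r * θ ^ 2 / (8 * γ) := by
    field_simp; ring
  have h15 : θ ^ 2 = t ^ 2 / (9 * V ^ 2) / a := by
    rw [hθ, div_pow, mul_pow, mul_pow, Real.sq_sqrt ha.le]; field_simp; ring
  have h16 : r * (1 - t ^ 2 / (72 * γ * V ^ 2) / a) = r - r * θ / (4 * γ) * θ + r * θ ^ 2 / (8 * γ) := by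
    have : r * θ / (4 * γ) * θ = r * θ ^ 2 / (4 * γ) := by ring
    rw [this, h15]; field_simp; ring
  rw [h16]; linarith

theorem WC.stage (H : WC q g t γ V f0 φ G T x v S ε) (m k : ℕ) (hm : m + k + v ≤ S)
    (A : Finset ι) (a b : ℝ) (ha : 0 < a) (hA : (A.card : ℝ) ≤ a)
    (hb : l2 x ((T \ wcT φ m) \ A) ≤ b) :
    q (f0 - G (m + k)) ≤ max (2 * (ε + Real.sqrt v * b))
      (Real.exp (-(t ^ 2 / (72 * γ * V ^ 2) / a * k)) * q (f0 - G m)) := by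
  induction k with
  | zero => simp
  | succ k ih =>
    have ih := ih (by omega)
    by_cases hr : 2 * (ε + Real.sqrt v * b) < q (f0 - G (m + k))
    · have hb' : l2 x ((T \ wcT φ (m + k)) \ A) ≤ b := by
        refine (l2_mono x ?_).trans hb
        exact Finset.sdiff_subset_sdiff (Finset.sdiff_subset_sdiff le_rfl
          (wcT_mono φ (Nat.le_add_right m k))) le_rfl
      have h1 := H.step (m + k) (by omega) A a b ha hA hb' hr
      have h2 : q (f0 - G (m + k)) ≤
          Real.exp (-(t ^ 2 / (72 * γ * V ^ 2) / a * k)) * q (f0 - G m) := by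
        rcases le_max_iff.mp ih with h | h
        · linarith
        · exact h
      refine le_max_of_le_right ?_
      set η := t ^ 2 / (72 * γ * V ^ 2) / a
      have h3 : 1 - η ≤ Real.exp (-η) := by linarith [Real.add_one_le_exp (-η)]
      have h4 : Real.exp (-(η * ((k + 1 : ℕ) : ℝ))) = Real.exp (-(η * k)) * Real.exp (-η) := by
        rw [← Real.exp_add]; congr 1; push_cast; ring
      rw [h4]
      calc q (f0 - G (m + k + 1)) ≤ q (f0 - G (m + k)) * (1 - η) := h1
        _ ≤ q (f0 - G (m + k)) * Real.exp (-η) :=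
          mul_le_mul_of_nonneg_left h3 (apply_nonneg _ _)
        _ ≤ (Real.exp (-(η * k)) * q (f0 - G m)) * Real.exp (-η) :=
          mul_le_mul_of_nonneg_right h2 (Real.exp_pos _).le
        _ = _ := by ring
    · push Not at hr
      exact le_max_of_le_left
        ((wc_mono g q t f0 φ G H.hw (by omega : m + k ≤ m + (k + 1))).trans hr)

end

theorem l2_empty {ι : Type*} (x : ι → ℂ) : l2 x ∅ = 0 := by simp [l2]

theorem exists_best_l2 {ι : Type*} (x : ι → ℂ) (Γ : Finset ι) (k : ℕ) :
    ∃ A : Finset ι, A.card ≤ k ∧ ∀ S ⊆ Γ, S.card ≤ k → l2 x (Γ \ A) ≤ l2 x (Γ \ S) := by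
  obtain ⟨A, hA, hmin⟩ := Finset.exists_min_image (Γ.powerset.filter (fun S => S.card ≤ k))
    (fun S => l2 x (Γ \ S)) ⟨∅, by simp⟩
  simp only [Finset.mem_filter, Finset.mem_powerset] at hA hmin
  exact ⟨A, hA.2, fun S h1 h2 => hmin S ⟨h1, h2⟩⟩

section
variable {X ι : Type*} {q : Seminorm ℂ (X → ℂ)} {g : ι → X → ℂ} {t γ V : ℝ}
    {f0 : X → ℂ} {φ : ℕ → ι} {G : ℕ → X → ℂ} {T : Finset ι} {x : ι → ℂ} {v S : ℕ} {ε : ℝ}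

theorem WC.round (H : WC q g t γ V f0 φ G T x v S ε) (K m : ℕ)
    (hK : 8 * V * Real.sqrt v ≤ Real.exp (t ^ 2 / (72 * γ * V ^ 2) * K))
    (hn : 0 < (T \ wcT φ m).card) (hS : m + 4 * K * (T \ wcT φ m).card + v ≤ S) :
    ∃ s : ℕ, 1 ≤ s ∧ s ≤ (T \ wcT φ m).card ∧
      (q (f0 - G (m + 4 * K * s)) ≤ 3 * ε ∨
        (T \ wcT φ (m + 4 * K * s)).card ≤ (T \ wcT φ m).card - s) := by
  set Γ := T \ wcT φ m with hΓ
  set n := Γ.card with hndef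
  choose A hAc hAm using exists_best_l2 x Γ
  set b : ℕ → ℝ := fun j => l2 x (Γ \ A (2 ^ j - 1)) with hb
  set β := 8 * V * Real.sqrt v with hβ
  have hV := H.hV
  have hε := H.eps_nonneg
  have hv1 : 1 ≤ Real.sqrt v := by
    rw [Real.one_le_sqrt]; exact_mod_cast H.hv
  have hβ8 : 8 ≤ β := by rw [hβ]; nlinarith
  have hb0 : ∀ j, 0 ≤ b j := fun j => l2_nonneg _ _
  have hbz : ∀ j, n ≤ 2 ^ j - 1 → b j = 0 := by
    intro j hj
    refine le_antisymm ?_ (hb0 j)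
    have := hAm (2 ^ j - 1) Γ le_rfl hj
    simpa [l2_empty] using this
  have hex : ∃ j, β * b (j + 1) ≤ b j := by
    refine ⟨n, ?_⟩
    rw [hbz (n + 1), mul_zero]
    · exact hb0 _
    · have : n + 1 < 2 ^ (n + 1) := Nat.lt_two_pow_self
      omega
  set j0 := Nat.find hex with hj0
  have hj0s : β * b (j0 + 1) ≤ b j0 := Nat.find_spec hex
  have hj0m : ∀ j < j0, b j < β * b (j + 1) := fun j hj => not_le.mp (Nat.find_min hex hj)
  have hs : 2 ^ j0 ≤ n := by
    by_cases h0 : j0 = 0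
    · rw [h0, pow_zero]; exact hn
    · by_contra hcon
      push Not at hcon
      obtain ⟨j, hj⟩ := Nat.exists_eq_succ_of_ne_zero h0
      have h1 := hj0m j (by omega)
      have h2 : b (j + 1) = 0 := by
        apply hbz; rw [← Nat.succ_eq_add_one, ← hj]; omega
      rw [h2, mul_zero] at h1
      linarith [hb0 j]
  have hexpK : Real.exp (-(t ^ 2 / (72 * γ * V ^ 2) * K)) * β ≤ 1 := by
    rw [Real.exp_neg, inv_mul_le_one₀ (Real.exp_pos _)]; exact hK
  set e := Real.exp (-(t ^ 2 / (72 * γ * V ^ 2) * K)) with he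
  have he0 : 0 < e := Real.exp_pos _
  -- general stage
  have hstage : ∀ j, j ≤ j0 → q (f0 - G (m + K * (2 ^ (j + 1) - 2))) ≤ 2 * (ε + Real.sqrt v * b j) →
      q (f0 - G (m + K * (2 ^ (j + 2) - 2))) ≤
        max (2 * (ε + Real.sqrt v * b (j + 1))) (e * (2 * (ε + Real.sqrt v * b j))) := by
    intro j hj hq
    have hidx : m + K * (2 ^ (j + 2) - 2) = m + K * (2 ^ (j + 1) - 2) + K * 2 ^ (j + 1) := by
      have h1 : 2 ^ (j + 2) - 2 = (2 ^ (j + 1) - 2) + 2 ^ (j + 1) := by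
        have : 1 ≤ 2 ^ j := Nat.one_le_two_pow
        rw [pow_succ, pow_succ]; omega
      rw [h1, mul_add, add_assoc]
    have hjj : 2 ^ j ≤ n := (Nat.pow_le_pow_right (by norm_num) hj).trans hs
    have hbd : m + K * (2 ^ (j + 2) - 2) + v ≤ S := by
      refine le_trans ?_ hS
      have : K * (2 ^ (j + 2) - 2) ≤ K * (4 * n) := by
        apply Nat.mul_le_mul_left; rw [pow_add]; omega
      have h3 : K * (4 * n) = 4 * K * n := by ring
      omega
    rw [hidx] at hbd
    have h1 := H.stage (m + K * (2 ^ (j + 1) - 2)) (K * 2 ^ (j + 1)) hbd (A (2 ^ (j + 1) - 1))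
      (2 ^ (j + 1)) (b (j + 1)) (by positivity) (by
        refine le_trans (Nat.cast_le.mpr (hAc (2 ^ (j + 1) - 1))) ?_
        have : 2 ^ (j + 1) - 1 ≤ 2 ^ (j + 1) := Nat.sub_le _ _
        exact_mod_cast this) (by
        apply l2_mono
        exact Finset.sdiff_subset_sdiff (Finset.sdiff_subset_sdiff le_rfl
          (wcT_mono φ (Nat.le_add_right _ _))) le_rfl)
    rw [hidx]
    refine h1.trans (max_le_max le_rfl ?_)
    have h2 : -(t ^ 2 / (72 * γ * V ^ 2) / 2 ^ (j + 1) * ((K * 2 ^ (j + 1) : ℕ) : ℝ))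
        = -(t ^ 2 / (72 * γ * V ^ 2) * K) := by
      have : ((2 : ℝ) ^ (j + 1)) ≠ 0 := by positivity
      push_cast; field_simp
    rw [h2]
    exact mul_le_mul_of_nonneg_left hq he0.le
  have hclaim : ∀ j, j ≤ j0 → q (f0 - G (m + K * (2 ^ (j + 1) - 2))) ≤ 2 * (ε + Real.sqrt v * b j) := by
    intro j
    induction j with
    | zero =>
      intro _
      have h1 := H.upper m
      have h2 : b 0 = l2 x Γ := by
        have : A 0 = ∅ := Finset.card_eq_zero.mp (Nat.le_zero.mp (hAc 0))
        simp [hb, this]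
      simp only [zero_add, pow_one, Nat.sub_self, mul_zero, add_zero, h2]
      have : 0 ≤ Real.sqrt v * l2 x Γ := mul_nonneg (Real.sqrt_nonneg _) (l2_nonneg _ _)
      linarith
    | succ j ih =>
      intro hj
      refine (hstage j (by omega) (ih (by omega))).trans (max_le le_rfl ?_)
      have h1 := hj0m j (by omega)
      have h2 : ε + Real.sqrt v * b j ≤ β * (ε + Real.sqrt v * b (j + 1)) := by
        have : Real.sqrt v * b j ≤ Real.sqrt v * (β * b (j + 1)) :=
          mul_le_mul_of_nonneg_left h1.le (Real.sqrt_nonneg _)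
        nlinarith
      have h3 : 0 ≤ ε + Real.sqrt v * b (j + 1) :=
        add_nonneg hε (mul_nonneg (Real.sqrt_nonneg _) (hb0 _))
      calc e * (2 * (ε + Real.sqrt v * b j))
          ≤ e * (2 * (β * (ε + Real.sqrt v * b (j + 1)))) := by gcongr
        _ = (e * β) * (2 * (ε + Real.sqrt v * b (j + 1))) := by ring
        _ ≤ 1 * (2 * (ε + Real.sqrt v * b (j + 1))) := by gcongr
        _ = _ := one_mul _
  have hlast : q (f0 - G (m + K * (2 ^ (j0 + 2) - 2))) ≤ b j0 / (4 * V) + 2 * ε := by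
    have hvb : Real.sqrt v * (b j0 / β) = b j0 / (8 * V) := by
      rw [hβ]; have : 0 < Real.sqrt v := by linarith
      field_simp
    refine (hstage j0 le_rfl (hclaim j0 le_rfl)).trans (max_le ?_ ?_)
    · have h1 : b (j0 + 1) ≤ b j0 / β := by
        rw [le_div_iff₀ (by linarith)]; linarith
      have h2 : Real.sqrt v * b (j0 + 1) ≤ Real.sqrt v * (b j0 / β) :=
        mul_le_mul_of_nonneg_left h1 (Real.sqrt_nonneg _)
      rw [hvb] at h2
      have h3 : b j0 / (4 * V) = 2 * (b j0 / (8 * V)) := by field_simp; ring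
      rw [h3]; linarith
    · have h1 : e ≤ 1 / β := by rw [le_div_iff₀ (by linarith)]; exact hexpK
      have h4 : 0 ≤ Real.sqrt v * b j0 := mul_nonneg (Real.sqrt_nonneg _) (hb0 _)
      have h5 : e ≤ 1 := h1.trans (by rw [div_le_one (by linarith)]; linarith)
      have h3 : b j0 / (4 * V) = 2 * (b j0 / (8 * V)) := by field_simp; ring
      rw [h3, ← hvb]
      have h6 : e * (Real.sqrt v * b j0) ≤ (1 / β) * (Real.sqrt v * b j0) :=
        mul_le_mul_of_nonneg_right h1 h4
      have h7 : (1 / β) * (Real.sqrt v * b j0) = Real.sqrt v * (b j0 / β) := by ring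
      rw [h7] at h6
      nlinarith
  have hq' : q (f0 - G (m + 4 * K * 2 ^ j0)) ≤ b j0 / (4 * V) + 2 * ε := by
    refine (wc_mono g q t f0 φ G H.hw ?_).trans hlast
    have : K * (2 ^ (j0 + 2) - 2) ≤ K * (4 * 2 ^ j0) := by
      apply Nat.mul_le_mul_left; rw [pow_add]; omega
    have h3 : K * (4 * 2 ^ j0) = 4 * K * 2 ^ j0 := by ring
    omega
  refine ⟨2 ^ j0, Nat.one_le_two_pow, hs, ?_⟩
  set m' := m + 4 * K * 2 ^ j0 with hm'
  have hsd : Γ \ (Γ ∩ wcT φ m') = T \ wcT φ m' := by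
    ext i
    simp only [hΓ, Finset.mem_sdiff, Finset.mem_inter]
    have : i ∈ wcT φ m → i ∈ wcT φ m' := fun h => wcT_mono φ (by omega) h
    tauto
  by_cases hc : (Γ ∩ wcT φ m').card ≤ 2 ^ j0 - 1
  · left
    have h1 := hAm (2 ^ j0 - 1) (Γ ∩ wcT φ m') Finset.inter_subset_left hc
    rw [hsd] at h1
    have hm's : m' + v ≤ S := by
      refine le_trans ?_ hS
      have : 4 * K * 2 ^ j0 ≤ 4 * K * n := Nat.mul_le_mul_left _ hs
      omega
    have h2 := H.coef m' hm's
    have h3 : b j0 ≤ V * (q (f0 - G m') + ε) := h1.trans h2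
    have h4 : V * (q (f0 - G m') + ε) ≤ V * (b j0 / (4 * V) + 2 * ε + ε) := by gcongr
    have h5 : V * (b j0 / (4 * V) + 2 * ε + ε) = b j0 / 4 + 3 * V * ε := by field_simp; ring
    have h6 : b j0 ≤ 4 * V * ε := by linarith
    have h7 : b j0 / (4 * V) ≤ ε := by rw [div_le_iff₀ (by linarith)]; linarith
    linarith
  · right
    push Not at hc
    rw [← hsd, Finset.card_sdiff_of_subset Finset.inter_subset_left]
    omega

theorem WC.final (H : WC q g t γ V f0 φ G T x v S ε) (K : ℕ)
    (hK : 8 * V * Real.sqrt v ≤ Real.exp (t ^ 2 / (72 * γ * V ^ 2) * K)) (n : ℕ) :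
    ∀ m, (T \ wcT φ m).card ≤ n → m + 4 * K * n + v ≤ S →
      q (f0 - G (m + 4 * K * n)) ≤ 3 * ε := by
  have hε := H.eps_nonneg
  induction n using Nat.strong_induction_on with
  | _ n ih =>
    intro m hc hS
    by_cases h0 : (T \ wcT φ m).card = 0
    · have h1 := H.upper m
      rw [Finset.card_eq_zero.mp h0, l2_empty, mul_zero, add_zero] at h1
      exact (wc_mono g q t f0 φ G H.hw (Nat.le_add_right _ _)).trans (by linarith)
    · have hle : 4 * K * (T \ wcT φ m).card ≤ 4 * K * n := Nat.mul_le_mul_left _ hc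
      obtain ⟨s, hs1, hsn, h | h⟩ := H.round K m hK (Nat.pos_of_ne_zero h0) (by omega)
      · refine (wc_mono g q t f0 φ G H.hw ?_).trans h
        have : 4 * K * s ≤ 4 * K * n := Nat.mul_le_mul_left _ (hsn.trans hc)
        omega
      · have hidx : m + 4 * K * s + 4 * K * (n - s) = m + 4 * K * n := by
          rw [add_assoc, ← mul_add]; congr 2; omega
        have := ih (n - s) (by omega) (m + 4 * K * s) (by omega) (by rw [hidx]; exact hS)
        rwa [hidx] at this

end

/-! ### Part 2: smoothness of the discrete `L_p` seminorm -/

theorem dNorm_eq {X : Type*} {m : ℕ} (ξ : Fin m → X) (p : ℝ) (f : X → ℂ) :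
    dNorm ξ p f = ((m : ℝ)⁻¹) ^ (1 / p) * (∑ j, ‖f (ξ j)‖ ^ p) ^ (1 / p) := by
  unfold dNorm
  rw [Real.mul_rpow (by positivity) (Finset.sum_nonneg fun _ _ => by positivity)]

theorem dNorm_nonneg {X : Type*} {m : ℕ} (ξ : Fin m → X) (p : ℝ) (f : X → ℂ) :
    0 ≤ dNorm ξ p f := by
  unfold dNorm; positivity

theorem dNorm_rpow {X : Type*} {m : ℕ} (ξ : Fin m → X) (p : ℝ) (hp : 0 < p) (f : X → ℂ) :
    dNorm ξ p f ^ p = (m : ℝ)⁻¹ * ∑ j, ‖f (ξ j)‖ ^ p := by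
  unfold dNorm
  rw [← Real.rpow_mul (by positivity), one_div_mul_cancel hp.ne', Real.rpow_one]

theorem dNorm_add_le {X : Type*} {m : ℕ} (ξ : Fin m → X) (p : ℝ) (hp : 1 ≤ p) (f g : X → ℂ) :
    dNorm ξ p (f + g) ≤ dNorm ξ p f + dNorm ξ p g := by
  rw [dNorm_eq, dNorm_eq, dNorm_eq, ← mul_add]
  refine mul_le_mul_of_nonneg_left ?_ (by positivity)
  have h1 := Real.Lp_add_le (Finset.univ) (fun j => ‖f (ξ j)‖) (fun j => ‖g (ξ j)‖) hp
  simp only [abs_norm] at h1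
  refine le_trans ?_ h1
  refine Real.rpow_le_rpow (Finset.sum_nonneg fun _ _ => by positivity)
    (Finset.sum_le_sum fun j _ => ?_) (by positivity)
  refine Real.rpow_le_rpow (norm_nonneg _) ?_ (by linarith)
  exact (norm_add_le _ _).trans (le_abs_self _)

theorem dNorm_smul {X : Type*} {m : ℕ} (ξ : Fin m → X) (p : ℝ) (hp : 1 ≤ p) (c : ℂ) (f : X → ℂ) :
    dNorm ξ p (c • f) = ‖c‖ * dNorm ξ p f := by
  have hp0 : p ≠ 0 := by linarith
  rw [dNorm_eq, dNorm_eq]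
  simp only [Pi.smul_apply, smul_eq_mul, norm_mul]
  have : ∀ j, (‖c‖ * ‖f (ξ j)‖) ^ p = ‖c‖ ^ p * ‖f (ξ j)‖ ^ p :=
    fun j => Real.mul_rpow (norm_nonneg _) (norm_nonneg _)
  simp only [this, ← Finset.mul_sum]
  rw [Real.mul_rpow (by positivity) (Finset.sum_nonneg fun _ _ => by positivity),
    ← Real.rpow_mul (norm_nonneg _), mul_one_div_cancel hp0, Real.rpow_one]
  ring

/-- The discrete norm as a seminorm. -/
def dSemi {X : Type*} {m : ℕ} (ξ : Fin m → X) (p : ℝ) (hp : 1 ≤ p) : Seminorm ℂ (X → ℂ) :=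
  Seminorm.of (dNorm ξ p) (dNorm_add_le ξ p hp) (dNorm_smul ξ p hp)

theorem scalar_aux (P b r : ℝ) (hP : 1 ≤ P) (hb : 0 ≤ b) (hb1 : b ≤ 1) (hr : |r| ≤ 2 * b)
    (h1 : 0 ≤ 1 + b ^ 2 + r) (h2 : 0 ≤ 1 + b ^ 2 - r) :
    (1 + b ^ 2 + r) ^ P + (1 + b ^ 2 - r) ^ P
      ≤ 2 + 2 * Real.exp (2 * (P + 2 * P ^ 2)) * b ^ 2 := by
  have e1 : (1 + b ^ 2 + r) ^ P ≤ Real.exp (P * b ^ 2) * Real.exp (P * r) := by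
    rw [← Real.exp_add]
    calc (1 + b ^ 2 + r) ^ P ≤ (Real.exp (b ^ 2 + r)) ^ P :=
          Real.rpow_le_rpow h1 (by linarith [Real.add_one_le_exp (b ^ 2 + r)]) (by linarith)
      _ = _ := by rw [← Real.exp_mul]; congr 1; ring
  have e2 : (1 + b ^ 2 - r) ^ P ≤ Real.exp (P * b ^ 2) * Real.exp (-(P * r)) := by
    rw [← Real.exp_add]
    calc (1 + b ^ 2 - r) ^ P ≤ (Real.exp (b ^ 2 - r)) ^ P :=
          Real.rpow_le_rpow h2 (by linarith [Real.add_one_le_exp (b ^ 2 - r)]) (by linarith)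
      _ = _ := by rw [← Real.exp_mul]; congr 1; ring
  have e3 : Real.exp (P * r) + Real.exp (-(P * r)) ≤ 2 * Real.exp ((P * r) ^ 2 / 2) := by
    have := Real.cosh_le_exp_half_sq (P * r)
    rw [Real.cosh_eq] at this
    linarith
  set D := P + 2 * P ^ 2 with hD
  have hD0 : 1 ≤ D := by rw [hD]; nlinarith
  have hr2 : r ^ 2 ≤ 4 * b ^ 2 := by
    have := sq_le_sq' (by linarith [neg_abs_le r, abs_nonneg r]) (le_trans (le_abs_self r) hr)
    nlinarith
  have e4 : Real.exp (P * b ^ 2) * (2 * Real.exp ((P * r) ^ 2 / 2)) ≤ 2 * Real.exp (D * b ^ 2) := by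
    have : P * b ^ 2 + (P * r) ^ 2 / 2 ≤ D * b ^ 2 := by
      have : P ^ 2 * r ^ 2 ≤ P ^ 2 * (4 * b ^ 2) := by gcongr
      rw [hD]; nlinarith
    calc Real.exp (P * b ^ 2) * (2 * Real.exp ((P * r) ^ 2 / 2))
        = 2 * Real.exp (P * b ^ 2 + (P * r) ^ 2 / 2) := by rw [Real.exp_add]; ring
      _ ≤ _ := by gcongr
  have hb2 : b ^ 2 ≤ 1 := by nlinarith
  have e5 : Real.exp (D * b ^ 2) ≤ 1 + Real.exp (2 * D) * b ^ 2 := by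
    have h3 : Real.exp (D * b ^ 2) * (1 - D * b ^ 2) ≤ 1 := by
      have : 1 - D * b ^ 2 ≤ Real.exp (-(D * b ^ 2)) := by
        linarith [Real.add_one_le_exp (-(D * b ^ 2))]
      calc _ ≤ Real.exp (D * b ^ 2) * Real.exp (-(D * b ^ 2)) := by gcongr
        _ = 1 := by rw [← Real.exp_add]; simp
    have h4 : Real.exp (D * b ^ 2) * (D * b ^ 2) ≤ Real.exp (2 * D) * b ^ 2 := by
      have h5 : D ≤ Real.exp D := by linarith [Real.add_one_le_exp D]
      have h6 : Real.exp (D * b ^ 2) ≤ Real.exp D :=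
        Real.exp_le_exp.mpr (by nlinarith)
      calc _ ≤ Real.exp D * (Real.exp D * b ^ 2) := by gcongr
        _ = Real.exp (2 * D) * b ^ 2 := by
          have h7 : Real.exp (2 * D) = Real.exp D * Real.exp D := by
            rw [← Real.exp_add, two_mul D]
          rw [h7, mul_assoc]
    linarith
  calc _ ≤ Real.exp (P * b ^ 2) * Real.exp (P * r) + Real.exp (P * b ^ 2) * Real.exp (-(P * r)) :=
        add_le_add e1 e2
    _ = Real.exp (P * b ^ 2) * (Real.exp (P * r) + Real.exp (-(P * r))) := by ring
    _ ≤ Real.exp (P * b ^ 2) * (2 * Real.exp ((P * r) ^ 2 / 2)) := by gcongr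
    _ ≤ 2 * Real.exp (D * b ^ 2) := e4
    _ ≤ _ := by linarith

theorem scalar_smooth (p : ℝ) (hp : 2 < p) (a b : ℂ) :
    ‖a + b‖ ^ p + ‖a - b‖ ^ p ≤ 2 * ‖a‖ ^ p
      + 2 * Real.exp (p + p ^ 2) * (‖a‖ ^ (p - 2) * ‖b‖ ^ 2 + ‖b‖ ^ p) := by
  have hE : 0 < Real.exp (p + p ^ 2) := Real.exp_pos _
  by_cases hab : ‖a‖ ≤ ‖b‖
  · have h2 : (2 : ℝ) ^ p ≤ Real.exp (p + p ^ 2) := by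
      have : (2 : ℝ) ≤ Real.exp 1 := by linarith [Real.add_one_le_exp (1 : ℝ)]
      calc (2 : ℝ) ^ p ≤ (Real.exp 1) ^ p := Real.rpow_le_rpow (by norm_num) this (by linarith)
        _ = Real.exp p := by rw [← Real.exp_mul, one_mul]
        _ ≤ _ := Real.exp_le_exp.mpr (by nlinarith)
    have h3 : (2 * ‖b‖) ^ p ≤ Real.exp (p + p ^ 2) * ‖b‖ ^ p := by
      rw [Real.mul_rpow (by norm_num) (norm_nonneg _)]; gcongr
    have h4 : ‖a + b‖ ^ p ≤ (2 * ‖b‖) ^ p :=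
      Real.rpow_le_rpow (norm_nonneg _) (by linarith [norm_add_le a b]) (by linarith)
    have h5 : ‖a - b‖ ^ p ≤ (2 * ‖b‖) ^ p :=
      Real.rpow_le_rpow (norm_nonneg _) (by linarith [norm_sub_le a b]) (by linarith)
    have h6 : 0 ≤ 2 * ‖a‖ ^ p := by positivity
    have h7 : 0 ≤ ‖a‖ ^ (p - 2) * ‖b‖ ^ 2 := by positivity
    nlinarith
  · push Not at hab
    have ha : 0 < ‖a‖ := (norm_nonneg b).trans_lt hab
    set β := ‖b‖ / ‖a‖ with hβ
    have hβ0 : 0 ≤ β := by positivity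
    have hβ1 : β ≤ 1 := by rw [hβ, div_le_one ha]; exact hab.le
    set ρ := 2 * (inner ℝ a b) / ‖a‖ ^ 2 with hρ
    have hbb : ‖b‖ = β * ‖a‖ := by rw [hβ]; field_simp
    have hp1 : ‖a + b‖ ^ 2 = ‖a‖ ^ 2 * (1 + β ^ 2 + ρ) := by
      rw [norm_add_sq_real, hρ, hbb]; field_simp; ring
    have hp2 : ‖a - b‖ ^ 2 = ‖a‖ ^ 2 * (1 + β ^ 2 - ρ) := by
      rw [norm_sub_sq_real, hρ, hbb]; field_simp; ring
    have hn1 : 0 ≤ 1 + β ^ 2 + ρ := by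
      by_contra hc; push Not at hc
      have : ‖a‖ ^ 2 * (1 + β ^ 2 + ρ) < 0 := mul_neg_of_pos_of_neg (by positivity) hc
      nlinarith [sq_nonneg ‖a + b‖]
    have hn2 : 0 ≤ 1 + β ^ 2 - ρ := by
      by_contra hc; push Not at hc
      have : ‖a‖ ^ 2 * (1 + β ^ 2 - ρ) < 0 := mul_neg_of_pos_of_neg (by positivity) hc
      nlinarith [sq_nonneg ‖a - b‖]
    have hρb : |ρ| ≤ 2 * β := by
      rw [hρ, abs_div, abs_mul, abs_of_pos (by positivity : (0 : ℝ) < ‖a‖ ^ 2),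
        div_le_iff₀ (by positivity)]
      have := abs_real_inner_le_norm a b
      rw [hbb] at this
      rw [abs_of_pos (two_pos : (0 : ℝ) < 2)]
      nlinarith
    have hpow : ∀ y : ℝ, 0 ≤ y → y ^ p = (y ^ 2) ^ (p / 2) := by
      intro y hy
      rw [← Real.rpow_natCast, ← Real.rpow_mul hy]; congr 1; push_cast; ring
    have key := scalar_aux (p / 2) β ρ (by linarith) hβ0 hβ1 hρb hn1 hn2
    have hexp : 2 * (p / 2 + 2 * (p / 2) ^ 2) = p + p ^ 2 := by ring
    rw [hexp] at key
    rw [hpow _ (norm_nonneg (a + b)), hpow _ (norm_nonneg (a - b)), hp1, hp2,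
      Real.mul_rpow (by positivity) hn1, Real.mul_rpow (by positivity) hn2,
      ← hpow _ (norm_nonneg a), ← mul_add]
    have h8 : ‖a‖ ^ (p - 2) * ‖b‖ ^ 2 = ‖a‖ ^ p * β ^ 2 := by
      rw [Real.rpow_sub ha, hβ, div_pow]
      have : ‖a‖ ^ (2 : ℝ) = ‖a‖ ^ 2 := by norm_cast
      rw [this]; field_simp
    rw [h8]
    have h9 : 0 ≤ ‖a‖ ^ p := by positivity
    have h10 : 0 ≤ ‖b‖ ^ p := by positivity
    have := mul_le_mul_of_nonneg_left key h9
    nlinarith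

theorem dNorm_smooth {X : Type*} {m : ℕ} (ξ : Fin m → X) (p : ℝ) (hp : 2 < p) (x y : X → ℂ)
    (hx : 0 < dNorm ξ p x) :
    dNorm ξ p (x + y) + dNorm ξ p (x - y) ≤ 2 * dNorm ξ p x
      + 2 * (3 * Real.exp (p + p ^ 2)) * (dNorm ξ p y) ^ 2 / dNorm ξ p x := by
  set E := Real.exp (p + p ^ 2) with hEdef
  have hE : 1 ≤ E := Real.one_le_exp (by nlinarith)
  have hp1 : 1 ≤ p := by linarith
  have hp0 : 0 < p := by linarith
  set a := dNorm ξ p x with ha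
  set b := dNorm ξ p y with hb
  have hb0 : 0 ≤ b := dNorm_nonneg _ _ _
  have hsub : dNorm ξ p (x - y) ≤ a + b := by
    have := map_sub_le_add (dSemi ξ p hp1) x y
    exact this
  have hadd : dNorm ξ p (x + y) ≤ a + b := dNorm_add_le ξ p hp1 x y
  rcases hb0.eq_or_lt with hb00 | hbpos
  · rw [← hb00] at hsub hadd ⊢
    simp only [ne_eq, OfNat.ofNat_ne_zero, not_false_eq_true, zero_pow, mul_zero, zero_div]
    linarith
  by_cases hab : a ≤ b
  · have : b ≤ b ^ 2 / a := by rw [le_div_iff₀ hx]; nlinarith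
    have h2 : 2 * (3 * E) * b ^ 2 / a = 6 * E * (b ^ 2 / a) := by ring
    rw [h2]
    have : 2 * b ≤ 6 * E * (b ^ 2 / a) := by nlinarith
    linarith
  push Not at hab
  set u := b / a with hu
  have hu0 : 0 < u := by positivity
  have hu1 : u ≤ 1 := by rw [hu, div_le_one hx]; exact hab.le
  have hpt : ∀ j, ‖(x + y) (ξ j)‖ ^ p + ‖(x - y) (ξ j)‖ ^ p ≤ 2 * ‖x (ξ j)‖ ^ p +
      2 * E * (u ^ 2 * (‖x (ξ j)‖ ^ p + ‖y (ξ j)‖ ^ p / u ^ p) + ‖y (ξ j)‖ ^ p) := by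
    intro j
    have h1 := scalar_smooth p hp (x (ξ j)) (y (ξ j))
    refine h1.trans ?_
    have h2 : ‖x (ξ j)‖ ^ (p - 2) * ‖y (ξ j)‖ ^ 2 ≤
        u ^ 2 * (‖x (ξ j)‖ ^ p + ‖y (ξ j)‖ ^ p / u ^ p) := by
      set A := ‖x (ξ j)‖
      set B := ‖y (ξ j)‖
      have hA : 0 ≤ A := norm_nonneg _
      have hB : 0 ≤ B := norm_nonneg _
      have h3 : B ^ p / u ^ p = (B / u) ^ p := by rw [Real.div_rpow hB hu0.le]
      have h4 : B ^ 2 = u ^ 2 * (B / u) ^ 2 := by field_simp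
      rw [h3, h4]
      set C := B / u
      have hC : 0 ≤ C := by positivity
      have hsp : ∀ z : ℝ, 0 ≤ z → z ^ p = z ^ (p - 2) * z ^ 2 := by
        intro z hz
        rw [← Real.rpow_natCast, ← Real.rpow_add_of_nonneg hz (by linarith) (by norm_num)]
        congr 1; push_cast; ring
      have h5 : A ^ (p - 2) * C ^ 2 ≤ A ^ p + C ^ p := by
        rcases le_total A C with h | h
        · have : A ^ (p - 2) * C ^ 2 ≤ C ^ (p - 2) * C ^ 2 := by
            have := Real.rpow_le_rpow hA h (by linarith : 0 ≤ p - 2)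
            gcongr
          rw [← hsp C hC] at this
          have : 0 ≤ A ^ p := by positivity
          linarith
        · have : A ^ (p - 2) * C ^ 2 ≤ A ^ (p - 2) * A ^ 2 := by gcongr
          rw [← hsp A hA] at this
          have : 0 ≤ C ^ p := by positivity
          linarith
      calc A ^ (p - 2) * (u ^ 2 * C ^ 2) = u ^ 2 * (A ^ (p - 2) * C ^ 2) := by ring
        _ ≤ _ := by gcongr
    gcongr
  have hsum : dNorm ξ p (x + y) ^ p + dNorm ξ p (x - y) ^ p ≤ 2 * a ^ p +
      2 * E * (u ^ 2 * (a ^ p + b ^ p / u ^ p) + b ^ p) := by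
    rw [ha, hb, dNorm_rpow ξ p hp0, dNorm_rpow ξ p hp0, dNorm_rpow ξ p hp0, dNorm_rpow ξ p hp0]
    have h1 := Finset.sum_le_sum (fun j (_ : j ∈ Finset.univ) => hpt j)
    have h2 := mul_le_mul_of_nonneg_left h1 (by positivity : 0 ≤ (m : ℝ)⁻¹)
    simp only [Finset.sum_add_distrib, ← Finset.mul_sum, ← Finset.sum_div] at h2
    rw [← mul_add]
    refine h2.trans (le_of_eq ?_)
    ring
  have hup : u ^ p ≤ u ^ 2 := by
    have := Real.rpow_le_rpow_of_exponent_ge hu0 hu1 hp.le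
    simpa using this
  have hbu : b ^ p = u ^ p * a ^ p := by
    rw [hu, Real.div_rpow hb0 hx.le]; field_simp
  have hap : 0 < a ^ p := by positivity
  have hupp : 0 < u ^ p := by positivity
  have hsum2 : dNorm ξ p (x + y) ^ p + dNorm ξ p (x - y) ^ p ≤ 2 * (a ^ p * (1 + 3 * E * u ^ 2)) := by
    refine hsum.trans ?_
    have h1 : b ^ p / u ^ p = a ^ p := by rw [hbu]; field_simp
    rw [h1, hbu]
    have : E * (u ^ p * a ^ p) ≤ E * (u ^ 2 * a ^ p) := by gcongr
    nlinarith
  set P1 := dNorm ξ p (x + y)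
  set P2 := dNorm ξ p (x - y)
  have hP1 : 0 ≤ P1 := dNorm_nonneg _ _ _
  have hP2 : 0 ≤ P2 := dNorm_nonneg _ _ _
  have hconv : ((P1 + P2) / 2) ^ p ≤ (P1 ^ p + P2 ^ p) / 2 := by
    have := (convexOn_rpow hp1).2 (Set.mem_Ici.mpr hP1) (Set.mem_Ici.mpr hP2)
      (by norm_num : (0 : ℝ) ≤ 1 / 2) (by norm_num : (0 : ℝ) ≤ 1 / 2) (by norm_num)
    simp only [smul_eq_mul] at this
    have e : (P1 + P2) / 2 = 1 / 2 * P1 + 1 / 2 * P2 := by ring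
    rw [e]; linarith
  have hfin : ((P1 + P2) / 2) ^ p ≤ (a * (1 + 3 * E * u ^ 2)) ^ p := by
    rw [Real.mul_rpow hx.le (by positivity)]
    have h1 : 1 + 3 * E * u ^ 2 ≤ (1 + 3 * E * u ^ 2) ^ p := by
      apply Real.self_le_rpow_of_one_le _ hp1
      have : 0 ≤ 3 * E * u ^ 2 := by positivity
      linarith
    have h2 : a ^ p * (1 + 3 * E * u ^ 2) ≤ a ^ p * (1 + 3 * E * u ^ 2) ^ p := by gcongr
    linarith
  have hfin2 := (Real.rpow_le_rpow_iff (by positivity) (by positivity) hp0).mp hfin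
  have h3 : 2 * (3 * E) * b ^ 2 / a = 2 * (a * (3 * E * u ^ 2)) := by rw [hu]; field_simp
  rw [h3]; linarith

/-! ### Part 3: empirical approximation and sampling -/

theorem exp_le_add_exp_sq (x : ℝ) : Real.exp x ≤ x + Real.exp (x ^ 2) := by
  have h1 := Real.add_one_le_exp (x ^ 2)
  by_cases h : |x| ≤ 1
  · have := (abs_le.mp (Real.abs_exp_sub_one_sub_id_le h)).2
    linarith
  · push Not at h
    rcases lt_abs.mp h with h | h
    · have : Real.exp x ≤ Real.exp (x ^ 2) := Real.exp_le_exp.mpr (by nlinarith)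
      linarith
    · have : Real.exp x ≤ 1 := Real.exp_le_one_iff.mpr (by linarith)
      nlinarith

theorem mgf_bound {Z : Type*} [Fintype Z] (w : Z → ℝ) (hw : ∀ z, 0 ≤ w z) (hw1 : ∑ z, w z = 1)
    (y : Z → ℝ) (hy : ∀ z, |y z| ≤ 2) (hm : ∑ z, w z * y z = 0) (l : ℝ) :
    ∑ z, w z * Real.exp (l * y z) ≤ Real.exp (4 * l ^ 2) := by
  calc ∑ z, w z * Real.exp (l * y z) ≤ ∑ z, w z * (l * y z + Real.exp (4 * l ^ 2)) := by
        refine Finset.sum_le_sum fun z _ => mul_le_mul_of_nonneg_left ?_ (hw z)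
        refine (exp_le_add_exp_sq _).trans (add_le_add le_rfl (Real.exp_le_exp.mpr ?_))
        have := sq_le_sq' (by linarith [neg_abs_le (y z), hy z]) (le_trans (le_abs_self _) (hy z))
        rw [mul_pow]; nlinarith [sq_nonneg l]
    _ = l * ∑ z, w z * y z + (∑ z, w z) * Real.exp (4 * l ^ 2) := by
        rw [Finset.mul_sum, Finset.sum_mul, ← Finset.sum_add_distrib]
        refine Finset.sum_congr rfl fun z _ => by ring
    _ = _ := by rw [hm, hw1]; ring

theorem exists_le_of_weighted {Z : Type*} [Fintype Z] (w : Z → ℝ) (hw : ∀ z, 0 ≤ w z)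
    (hw1 : ∑ z, w z = 1) (a : Z → ℝ) (b : ℝ) (h : ∑ z, w z * a z ≤ b) : ∃ z, a z ≤ b := by
  by_contra hcon
  push Not at hcon
  have hex : ∃ z, 0 < w z := by
    by_contra h0
    push Not at h0
    have : ∑ z, w z ≤ 0 := Finset.sum_nonpos fun z _ => h0 z
    linarith
  obtain ⟨z0, hz0⟩ := hex
  have h2 : ∑ z, w z * b < ∑ z, w z * a z := by
    refine Finset.sum_lt_sum (fun z _ => mul_le_mul_of_nonneg_left (hcon z).le (hw z))
      ⟨z0, Finset.mem_univ _, mul_lt_mul_of_pos_left (hcon z0) hz0⟩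
  rw [← Finset.sum_mul, hw1, one_mul] at h2
  linarith

theorem maurey_induct {X Z κ : Type*} [MeasurableSpace X] [Fintype Z] [Fintype κ]
    (ρ : Measure X) [IsFiniteMeasure ρ]
    (w : Z → ℝ) (hw : ∀ z, 0 ≤ w z) (hw1 : ∑ z, w z = 1)
    (Y : κ → Z → X → ℝ) (hYm : ∀ k z, Measurable (Y k z)) (hY : ∀ k z x, |Y k z x| ≤ 2)
    (hmean : ∀ k x, ∑ z, w z * Y k z x = 0) (l : ℝ) (n : ℕ) :
    ∀ W : κ → X → ℝ, (∀ k x, 0 ≤ W k x) → (∀ k, Integrable (W k) ρ) →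
      ∃ z : Fin n → Z, (∀ k, Integrable (fun x => W k x * ∏ j, Real.exp (l * Y k (z j) x)) ρ) ∧
        ∑ k, ∫ x, W k x * ∏ j, Real.exp (l * Y k (z j) x) ∂ρ
          ≤ Real.exp (4 * l ^ 2) ^ n * ∑ k, ∫ x, W k x ∂ρ := by
  induction n with
  | zero => intro W hW hWi; exact ⟨Fin.elim0, by simpa using hWi, by simp⟩
  | succ n ih =>
    intro W hW hWi
    have hint : ∀ k z, Integrable (fun x => W k x * Real.exp (l * Y k z x)) ρ := by
      intro k z
      refine (hWi k).mul_bdd (c := Real.exp (|l| * 2)) ?_ ?_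
      · exact (Real.measurable_exp.comp ((hYm k z).const_mul l)).aestronglyMeasurable
      · refine Filter.Eventually.of_forall fun x => ?_
        rw [Real.norm_eq_abs, Real.abs_exp]
        refine Real.exp_le_exp.mpr ((le_abs_self _).trans ?_)
        rw [abs_mul]
        exact mul_le_mul_of_nonneg_left (hY k z x) (abs_nonneg _)
    obtain ⟨z0, hz0⟩ := exists_le_of_weighted w hw hw1
      (fun z => ∑ k, ∫ x, W k x * Real.exp (l * Y k z x) ∂ρ)
      (Real.exp (4 * l ^ 2) * ∑ k, ∫ x, W k x ∂ρ) (by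
        simp only [Finset.mul_sum]
        rw [Finset.sum_comm]
        refine Finset.sum_le_sum fun k _ => ?_
        have h1 : ∑ z, w z * ∫ x, W k x * Real.exp (l * Y k z x) ∂ρ
            = ∫ x, ∑ z, w z * (W k x * Real.exp (l * Y k z x)) ∂ρ := by
          rw [integral_finset_sum]
          · refine Finset.sum_congr rfl fun z _ => ?_
            rw [integral_const_mul]
          · intro z _; exact (hint k z).const_mul _
        rw [h1, ← integral_const_mul]
        refine integral_mono (integrable_finset_sum _ fun z _ => (hint k z).const_mul _)
          ((hWi k).const_mul _) fun x => ?_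
        have h2 := mgf_bound w hw hw1 (fun z => Y k z x) (fun z => hY k z x) (hmean k x) l
        calc ∑ z, w z * (W k x * Real.exp (l * Y k z x))
            = W k x * ∑ z, w z * Real.exp (l * Y k z x) := by
              rw [Finset.mul_sum]; refine Finset.sum_congr rfl fun z _ => by ring
          _ ≤ W k x * Real.exp (4 * l ^ 2) := mul_le_mul_of_nonneg_left h2 (hW k x)
          _ = _ := mul_comm _ _)
    obtain ⟨z, hzi, hz⟩ := ih (fun k x => W k x * Real.exp (l * Y k z0 x))
      (fun k x => mul_nonneg (hW k x) (Real.exp_pos _).le) (fun k => hint k z0)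
    have e : ∀ k x, W k x * ∏ j, Real.exp (l * Y k ((Fin.cons z0 z : Fin (n + 1) → Z) j) x)
        = W k x * Real.exp (l * Y k z0 x) * ∏ j, Real.exp (l * Y k (z j) x) := by
      intro k x
      rw [Fin.prod_univ_succ]; simp only [Fin.cons_zero, Fin.cons_succ]; ring
    refine ⟨Fin.cons z0 z, ?_, ?_⟩
    · intro k; simp only [e]; exact hzi k
    · simp only [e]
      refine hz.trans ?_
      calc _ ≤ Real.exp (4 * l ^ 2) ^ n * (Real.exp (4 * l ^ 2) * ∑ k, ∫ x, W k x ∂ρ) := by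
            gcongr
        _ = _ := by ring

theorem maurey {X Z : Type*} [MeasurableSpace X] [Fintype Z]
    (ρ : Measure X) [IsFiniteMeasure ρ]
    (w : Z → ℝ) (hw : ∀ z, 0 ≤ w z) (hw1 : ∑ z, w z = 1)
    (ψ : Z → X → ℂ) (hψm : ∀ z, Measurable (ψ z)) (hψ : ∀ z x, ‖ψ z x‖ ≤ 1)
    (F : X → ℂ) (hF : ∀ x, F x = ∑ z, (w z : ℂ) * ψ z x) (n : ℕ) (τ : ℝ) (hτ : 0 ≤ τ) :
    ∃ z : Fin n → Z, ρ.real {x | 2 * n * τ ≤ ‖∑ j, ψ (z j) x - n * F x‖}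
      ≤ 4 * Real.exp (-(n * τ ^ 2 / 16)) * ρ.real Set.univ := by
  have hFm : Measurable F := by
    have : F = fun x => ∑ z, (w z : ℂ) * ψ z x := funext hF
    rw [this]
    exact Finset.measurable_sum _ fun z _ => (hψm z).const_mul _
  have hF1 : ∀ x, ‖F x‖ ≤ 1 := by
    intro x
    rw [hF, ← hw1]
    refine (norm_sum_le _ _).trans (Finset.sum_le_sum fun z _ => ?_)
    rw [norm_mul, Complex.norm_real, Real.norm_eq_abs, abs_of_nonneg (hw z)]
    exact mul_le_of_le_one_right (hw z) (hψ z x)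
  have hd : ∀ z x, ‖ψ z x - F x‖ ≤ 2 := fun z x =>
    (norm_sub_le _ _).trans (by linarith [hψ z x, hF1 x])
  have hwc : ∑ z, (w z : ℂ) = 1 := by exact_mod_cast hw1
  have hmeanC : ∀ x, ∑ z, (w z : ℂ) * (ψ z x - F x) = 0 := by
    intro x
    simp only [mul_sub, Finset.sum_sub_distrib, ← Finset.sum_mul, hwc, one_mul]
    rw [hF x, sub_self]
  have hre : ∀ x, ∑ z, w z * (ψ z x - F x).re = 0 := by
    intro x
    have := congrArg Complex.re (hmeanC x)
    simpa [Complex.re_sum] using this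
  have him : ∀ x, ∑ z, w z * (ψ z x - F x).im = 0 := by
    intro x
    have := congrArg Complex.im (hmeanC x)
    simpa [Complex.im_sum] using this
  set Y : Fin 4 → Z → X → ℝ := fun k z x =>
    (![(ψ z x - F x).re, -(ψ z x - F x).re, (ψ z x - F x).im, -(ψ z x - F x).im] : Fin 4 → ℝ) k
    with hYdef
  have hdm : ∀ z, Measurable (fun x => ψ z x - F x) := fun z => (hψm z).sub hFm
  have hYm : ∀ k z, Measurable (Y k z) := by
    intro k z
    fin_cases k
    · exact Complex.measurable_re.comp (hdm z)
    · exact (Complex.measurable_re.comp (hdm z)).neg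
    · exact Complex.measurable_im.comp (hdm z)
    · exact (Complex.measurable_im.comp (hdm z)).neg
  have hY : ∀ k z x, |Y k z x| ≤ 2 := by
    intro k z x
    have h1 := (Complex.abs_re_le_norm (ψ z x - F x)).trans (hd z x)
    have h2 := (Complex.abs_im_le_norm (ψ z x - F x)).trans (hd z x)
    fin_cases k
    · exact h1
    · show |-(ψ z x - F x).re| ≤ 2
      rw [abs_neg]; exact h1
    · exact h2
    · show |-(ψ z x - F x).im| ≤ 2
      rw [abs_neg]; exact h2
  have hmean : ∀ k x, ∑ z, w z * Y k z x = 0 := by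
    intro k x
    fin_cases k
    · exact hre x
    · show ∑ z, w z * -(ψ z x - F x).re = 0
      simp only [mul_neg, Finset.sum_neg_distrib, hre x, neg_zero]
    · exact him x
    · show ∑ z, w z * -(ψ z x - F x).im = 0
      simp only [mul_neg, Finset.sum_neg_distrib, him x, neg_zero]
  obtain ⟨z, hzi, hz⟩ := maurey_induct ρ w hw hw1 Y hYm hY hmean (τ / 8) n (fun _ _ => 1)
    (fun _ _ => zero_le_one) (fun _ => integrable_const _)
  refine ⟨z, ?_⟩
  simp only [one_mul, integral_const, smul_eq_mul, mul_one, Finset.sum_const, Finset.card_univ,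
    Fintype.card_fin, nsmul_eq_mul, ← Real.exp_sum, ← Finset.mul_sum] at hz hzi
  have hmk : ∀ k, ρ.real {x | n * τ ≤ ∑ j, Y k (z j) x} ≤
      Real.exp (-(n * τ ^ 2 / 8)) * ∫ x, Real.exp (τ / 8 * ∑ j, Y k (z j) x) ∂ρ := by
    intro k
    have h1 := mul_meas_ge_le_integral_of_nonneg (μ := ρ)
      (f := fun x => Real.exp (τ / 8 * ∑ j, Y k (z j) x))
      (Filter.Eventually.of_forall fun x => (Real.exp_pos _).le) (hzi k)
      (Real.exp (n * τ ^ 2 / 8))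
    have h2 : ρ.real {x | n * τ ≤ ∑ j, Y k (z j) x} ≤
        ρ.real {x | Real.exp (n * τ ^ 2 / 8) ≤ Real.exp (τ / 8 * ∑ j, Y k (z j) x)} := by
      refine measureReal_mono ?_
      intro x hx
      simp only [Set.mem_setOf_eq] at hx ⊢
      refine Real.exp_le_exp.mpr ?_
      have := mul_le_mul_of_nonneg_left hx (by positivity : 0 ≤ τ / 8)
      linarith
    rw [Real.exp_neg, inv_mul_eq_div, le_div_iff₀ (Real.exp_pos _)]
    refine le_trans ?_ h1
    rw [mul_comm]
    exact mul_le_mul_of_nonneg_left h2 (Real.exp_pos _).le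
  have hsub : {x | 2 * n * τ ≤ ‖∑ j, ψ (z j) x - n * F x‖} ⊆
      ⋃ k, {x | n * τ ≤ ∑ j, Y k (z j) x} := by
    intro x hx
    simp only [Set.mem_setOf_eq, Set.mem_iUnion] at hx ⊢
    by_contra hcon
    push Not at hcon
    have e : ∑ j, ψ (z j) x - n * F x = ∑ j, (ψ (z j) x - F x) := by
      rw [Finset.sum_sub_distrib]; simp
    have r0 : (∑ j, ψ (z j) x - n * F x).re < n * τ := by
      rw [e, Complex.re_sum]; exact hcon 0
    have r1 : -(∑ j, ψ (z j) x - n * F x).re < n * τ := by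
      rw [e, Complex.re_sum, ← Finset.sum_neg_distrib]; exact hcon 1
    have r2 : (∑ j, ψ (z j) x - n * F x).im < n * τ := by
      rw [e, Complex.im_sum]; exact hcon 2
    have r3 : -(∑ j, ψ (z j) x - n * F x).im < n * τ := by
      rw [e, Complex.im_sum, ← Finset.sum_neg_distrib]; exact hcon 3
    have h1 := Complex.norm_le_abs_re_add_abs_im (∑ j, ψ (z j) x - n * F x)
    have h2 := max_lt r0 r1
    have h3 := max_lt r2 r3
    change |_| < _ at h2
    change |_| < _ at h3
    linarith
  calc ρ.real {x | 2 * n * τ ≤ ‖∑ j, ψ (z j) x - n * F x‖}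
      ≤ ρ.real (⋃ k, {x | n * τ ≤ ∑ j, Y k (z j) x}) := measureReal_mono hsub
    _ ≤ ∑ k, ρ.real {x | n * τ ≤ ∑ j, Y k (z j) x} := measureReal_iUnion_fintype_le _
    _ ≤ ∑ k, Real.exp (-(n * τ ^ 2 / 8)) * ∫ x, Real.exp (τ / 8 * ∑ j, Y k (z j) x) ∂ρ :=
        Finset.sum_le_sum fun k _ => hmk k
    _ = Real.exp (-(n * τ ^ 2 / 8)) * ∑ k, ∫ x, Real.exp (τ / 8 * ∑ j, Y k (z j) x) ∂ρ := by
        rw [Finset.mul_sum]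
    _ ≤ Real.exp (-(n * τ ^ 2 / 8)) *
        (Real.exp (4 * (τ / 8) ^ 2) ^ n * (((4 : ℕ) : ℝ) * ρ.real Set.univ)) := by gcongr
    _ = _ := by
        rw [← Real.exp_nat_mul, ← mul_assoc, ← Real.exp_add]
        have : -(n * τ ^ 2 / 8) + n * (4 * (τ / 8) ^ 2) = -(n * τ ^ 2 / 16) := by ring
        rw [this]; push_cast; ring

theorem sampling_induct {X α : Type*} [MeasurableSpace X] [Fintype α]
    (μ : Measure X) [IsProbabilityMeasure μ] (E : α → Set X) (hE : ∀ a, MeasurableSet (E a))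
    (n : ℕ) : ∀ W : α → ℝ, (∀ a, 0 ≤ W a) →
      ∃ ξ : Fin n → X, ∑ a, W a * ∏ j, (1 - (E a).indicator (fun _ => (1 / 2 : ℝ)) (ξ j))
        ≤ ∑ a, W a * (1 - μ.real (E a) / 2) ^ n := by
  induction n with
  | zero => intro W hW; exact ⟨Fin.elim0, by simp⟩
  | succ n ih =>
    intro W hW
    have hle : ∀ a, 0 ≤ 1 - μ.real (E a) / 2 := by
      intro a; have : μ.real (E a) ≤ 1 := measureReal_le_one
      linarith
    have hind : ∀ a, Integrable ((E a).indicator (fun _ => (1 / 2 : ℝ))) μ :=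
      fun a => (integrable_const _).indicator (hE a)
    set f : X → ℝ := fun x => ∑ a, W a * (1 - μ.real (E a) / 2) ^ n *
      (1 - (E a).indicator (fun _ => (1 / 2 : ℝ)) x) with hf
    have hi : ∀ a, Integrable (fun x => W a * (1 - μ.real (E a) / 2) ^ n *
      (1 - (E a).indicator (fun _ => (1 / 2 : ℝ)) x)) μ := fun a =>
        ((integrable_const (1 : ℝ)).sub (hind a)).const_mul _
    have hfi : Integrable f μ := integrable_finset_sum _ fun a _ => hi a
    obtain ⟨x, hx⟩ := exists_le_integral hfi
    have hint : ∫ x, f x ∂μ = ∑ a, W a * (1 - μ.real (E a) / 2) ^ (n + 1) := by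
      rw [hf, integral_finset_sum _ fun a _ => hi a]
      refine Finset.sum_congr rfl fun a _ => ?_
      rw [integral_const_mul, integral_sub (integrable_const _) (hind a),
        integral_indicator_const _ (hE a)]
      simp; ring
    rw [hint] at hx
    obtain ⟨ξ, hξ⟩ := ih (fun a => W a * (1 - (E a).indicator (fun _ => (1 / 2 : ℝ)) x)) (by
      intro a
      refine mul_nonneg (hW a) ?_
      by_cases h : x ∈ E a <;> simp [h]; norm_num)
    refine ⟨Fin.cons x ξ, ?_⟩
    calc _ = ∑ a, W a * (1 - (E a).indicator (fun _ => (1 / 2 : ℝ)) x) *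
          ∏ j, (1 - (E a).indicator (fun _ => (1 / 2 : ℝ)) (ξ j)) := by
          refine Finset.sum_congr rfl fun a _ => ?_
          rw [Fin.prod_univ_succ]; simp only [Fin.cons_zero, Fin.cons_succ]; ring
      _ ≤ _ := hξ
      _ = f x := by
          rw [hf]; refine Finset.sum_congr rfl fun a _ => by ring
      _ ≤ _ := hx

/-- empirical frequency -/
def emp {X : Type*} {m : ℕ} (ξ : Fin m → X) (E : Set X) : ℝ :=
  (m : ℝ)⁻¹ * ∑ j, E.indicator (fun _ => (1 : ℝ)) (ξ j)

theorem sampling {X α : Type*} [MeasurableSpace X] [Fintype α]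
    (μ : Measure X) [IsProbabilityMeasure μ] (E : α → Set X) (hE : ∀ a, MeasurableSet (E a))
    (m : ℕ) (hm : 0 < m) (h : ∑ a, Real.exp (-(m * μ.real (E a) / 4)) < 1) :
    ∃ ξ : Fin m → X, ∀ a, μ.real (E a) ≤ 4 * emp ξ (E a) := by
  obtain ⟨ξ, hξ⟩ := sampling_induct μ E hE m (fun a => Real.exp (m * μ.real (E a) / 4))
    (fun a => (Real.exp_pos _).le)
  refine ⟨ξ, fun a => ?_⟩
  by_contra hcon
  push Not at hcon
  have hmR : (0 : ℝ) < m := by exact_mod_cast hm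
  have h1 : ∑ a, Real.exp (m * μ.real (E a) / 4) * (1 - μ.real (E a) / 2) ^ m < 1 := by
    refine lt_of_le_of_lt (Finset.sum_le_sum fun a _ => ?_) h
    have h2 : (1 - μ.real (E a) / 2) ^ m ≤ Real.exp (-(μ.real (E a) / 2)) ^ m := by
      refine pow_le_pow_left₀ ?_ ?_ m
      · have : μ.real (E a) ≤ 1 := measureReal_le_one
        linarith
      · linarith [Real.add_one_le_exp (-(μ.real (E a) / 2))]
    calc _ ≤ Real.exp (m * μ.real (E a) / 4) * Real.exp (-(μ.real (E a) / 2)) ^ m := by gcongr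
      _ = _ := by rw [← Real.exp_nat_mul, ← Real.exp_add]; congr 1; ring
  have h2 : 1 ≤ Real.exp (m * μ.real (E a) / 4) *
      ∏ j, (1 - (E a).indicator (fun _ => (1 / 2 : ℝ)) (ξ j)) := by
    have h3 : ∏ j, (1 - (E a).indicator (fun _ => (1 / 2 : ℝ)) (ξ j)) ≥
        ∏ j, Real.exp (-((E a).indicator (fun _ => (1 : ℝ)) (ξ j))) := by
      refine Finset.prod_le_prod (fun j _ => (Real.exp_pos _).le) fun j _ => ?_
      by_cases hj : ξ j ∈ E a
      · simp only [hj, Set.indicator_of_mem]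
        have : Real.exp (-1) ≤ 1 / 2 := by
          rw [Real.exp_neg, one_div]
          exact inv_anti₀ two_pos (by linarith [Real.add_one_le_exp (1 : ℝ)])
        linarith
      · simp [hj]
    rw [← Real.exp_sum, Finset.sum_neg_distrib] at h3
    have h4 : ∑ j, (E a).indicator (fun _ => (1 : ℝ)) (ξ j) ≤ m * μ.real (E a) / 4 := by
      unfold emp at hcon
      have : (m : ℝ)⁻¹ * ∑ j, (E a).indicator (fun _ => (1 : ℝ)) (ξ j) < μ.real (E a) / 4 := by
        linarith
      rw [inv_mul_lt_iff₀ hmR] at this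
      linarith
    calc (1 : ℝ) ≤ Real.exp (m * μ.real (E a) / 4) *
          Real.exp (-(∑ j, (E a).indicator (fun _ => (1 : ℝ)) (ξ j))) := by
          rw [← Real.exp_add]; exact Real.one_le_exp (by linarith)
      _ ≤ _ := by gcongr
  have h3 : Real.exp (m * μ.real (E a) / 4) *
      ∏ j, (1 - (E a).indicator (fun _ => (1 / 2 : ℝ)) (ξ j)) ≤
      ∑ a, Real.exp (m * μ.real (E a) / 4) *
      ∏ j, (1 - (E a).indicator (fun _ => (1 / 2 : ℝ)) (ξ j)) := by
    refine Finset.single_le_sum (f := fun a => Real.exp (m * μ.real (E a) / 4) *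
      ∏ j, (1 - (E a).indicator (fun _ => (1 / 2 : ℝ)) (ξ j))) (fun b _ => ?_) (Finset.mem_univ a)
    refine mul_nonneg (Real.exp_pos _).le (Finset.prod_nonneg fun j _ => ?_)
    by_cases h : ξ j ∈ E b <;> simp [h]; norm_num
  linarith

/-- The five multipliers used in the empirical approximation. -/
def unit5 : Fin 5 → ℂ := ![1, -1, Complex.I, -Complex.I, 0]

theorem unit5_norm (s : Fin 5) : ‖unit5 s‖ ≤ 1 := by
  fin_cases s <;> simp [unit5]

/-- Elements of the net. -/
def hnet {X : Type*} {N : ℕ} (g : Fin N → X → ℂ) (K : ℝ) (n : ℕ) (z : Fin n → Fin N × Fin 5)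
    (x : X) : ℂ := ((2 * K / n : ℝ) : ℂ) * ∑ j, unit5 (z j).2 * g (z j).1 x

theorem net_approx {X : Type*} [MeasurableSpace X] (ρ : Measure X) [IsFiniteMeasure ρ]
    {N : ℕ} (hN : 0 < N) (g : Fin N → X → ℂ) (hgm : ∀ i, Measurable (g i))
    (hg : ∀ i x, ‖g i x‖ ≤ 1) (c : Fin N → ℂ) (K : ℝ) (hK : 0 < K) (hc : ∑ i, ‖c i‖ ≤ K)
    (n : ℕ) (hn : 0 < n) (τ : ℝ) (hτ : 0 ≤ τ) :
    ∃ z : Fin n → Fin N × Fin 5,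
      ρ.real {x | 4 * K * τ ≤ ‖(∑ i, c i * g i x) - hnet g K n z x‖}
        ≤ 4 * Real.exp (-(n * τ ^ 2 / 16)) * ρ.real Set.univ := by
  have hNR : (0 : ℝ) < N := by exact_mod_cast hN
  have hnR : (0 : ℝ) < n := by exact_mod_cast hn
  set S : ℝ := ∑ i, (|(c i).re| + |(c i).im|) / (2 * K) with hS
  have hS1 : S ≤ 1 := by
    rw [hS, ← Finset.sum_div, div_le_one (by positivity)]
    calc ∑ i, (|(c i).re| + |(c i).im|) ≤ ∑ i, 2 * ‖c i‖ :=
          Finset.sum_le_sum fun i _ => by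
            linarith [Complex.abs_re_le_norm (c i), Complex.abs_im_le_norm (c i)]
      _ ≤ 2 * K := by rw [← Finset.mul_sum]; linarith
  set w : Fin N × Fin 5 → ℝ := fun a =>
    (![max (c a.1).re 0 / (2 * K), max (-(c a.1).re) 0 / (2 * K), max (c a.1).im 0 / (2 * K),
      max (-(c a.1).im) 0 / (2 * K), (1 - S) / N] : Fin 5 → ℝ) a.2 with hw
  have hw0 : ∀ a, 0 ≤ w a := by
    rintro ⟨i, s⟩
    fin_cases s
    · exact div_nonneg (le_max_right _ _) (by positivity)
    · exact div_nonneg (le_max_right _ _) (by positivity)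
    · exact div_nonneg (le_max_right _ _) (by positivity)
    · exact div_nonneg (le_max_right _ _) (by positivity)
    · exact div_nonneg (by linarith) hNR.le
  have habs : ∀ r : ℝ, max r 0 + max (-r) 0 = |r| := by
    intro r
    rcases le_total 0 r with h | h
    · rw [max_eq_left h, max_eq_right (by linarith), abs_of_nonneg h]; ring
    · rw [max_eq_right h, max_eq_left (by linarith), abs_of_nonpos h]; ring
  have hsubm : ∀ r : ℝ, max r 0 - max (-r) 0 = r := by
    intro r
    rcases le_total 0 r with h | h
    · rw [max_eq_left h, max_eq_right (by linarith)]; ring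
    · rw [max_eq_right h, max_eq_left (by linarith)]; ring
  have hw1 : ∑ a, w a = 1 := by
    rw [Fintype.sum_prod_type]
    have : ∀ i, ∑ s, w (i, s) = (|(c i).re| + |(c i).im|) / (2 * K) + (1 - S) / N := by
      intro i
      simp only [hw, Fin.sum_univ_five]
      simp only [Matrix.cons_val]
      rw [← habs, ← habs]; ring
    simp only [this, Finset.sum_add_distrib]
    rw [← hS]
    simp only [Finset.sum_const, Finset.card_univ, Fintype.card_fin, nsmul_eq_mul]
    field_simp; ring
  set F : X → ℂ := fun x => (∑ i, c i * g i x) / ((2 * K : ℝ) : ℂ) with hFdef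
  have hKC : ((2 * K : ℝ) : ℂ) ≠ 0 := by exact_mod_cast (by positivity : 2 * K ≠ 0)
  have hF : ∀ x, F x = ∑ a, (w a : ℂ) * (unit5 a.2 * g a.1 x) := by
    intro x
    rw [Fintype.sum_prod_type, hFdef]
    simp only
    rw [Finset.sum_div]
    refine Finset.sum_congr rfl fun i _ => ?_
    simp only [hw, Fin.sum_univ_five, unit5]
    simp only [Matrix.cons_val]
    have h1 : c i = ((max (c i).re 0 - max (-(c i).re) 0 : ℝ) : ℂ)
        + ((max (c i).im 0 - max (-(c i).im) 0 : ℝ) : ℂ) * Complex.I := by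
      rw [hsubm, hsubm, Complex.re_add_im]
    have h2 : ∀ a b a' b' : ℝ, ∀ y : ℂ,
        (((a - b : ℝ) : ℂ) + ((a' - b' : ℝ) : ℂ) * Complex.I) * y / ((2 * K : ℝ) : ℂ) =
        ((a / (2 * K) : ℝ) : ℂ) * (1 * y) + ((b / (2 * K) : ℝ) : ℂ) * (-1 * y)
        + ((a' / (2 * K) : ℝ) : ℂ) * (Complex.I * y)
        + ((b' / (2 * K) : ℝ) : ℂ) * (-Complex.I * y)
        + (((1 - S) / N : ℝ) : ℂ) * (0 * y) := by
      intro a b a' b' y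
      push_cast
      have : (K : ℂ) ≠ 0 := by exact_mod_cast hK.ne'
      field_simp; ring
    conv_lhs => rw [h1]
    exact h2 _ _ _ _ _
  obtain ⟨z, hz⟩ := maurey ρ w hw0 hw1 (fun a x => unit5 a.2 * g a.1 x)
    (fun a => (hgm a.1).const_mul _)
    (fun a x => by
      rw [norm_mul]; exact mul_le_one₀ (unit5_norm _) (norm_nonneg _) (hg _ _)) F hF n τ hτ
  refine ⟨z, ?_⟩
  have hset : {x | 4 * K * τ ≤ ‖(∑ i, c i * g i x) - hnet g K n z x‖} =
      {x | 2 * n * τ ≤ ‖∑ j, unit5 (z j).2 * g (z j).1 x - n * F x‖} := by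
    ext x
    simp only [Set.mem_setOf_eq]
    have e : (∑ i, c i * g i x) - hnet g K n z x = ((-(2 * K / n) : ℝ) : ℂ) *
        (∑ j, unit5 (z j).2 * g (z j).1 x - n * F x) := by
      simp only [hnet, hFdef]
      have : (n : ℂ) ≠ 0 := by exact_mod_cast hn.ne'
      have : (K : ℂ) ≠ 0 := by exact_mod_cast hK.ne'
      push_cast
      field_simp; ring
    rw [e, norm_mul, Complex.norm_real, Real.norm_eq_abs, abs_neg,
      abs_of_pos (by positivity : 0 < 2 * K / n)]
    have : 4 * K * τ = 2 * K / n * (2 * n * τ) := by field_simp; ring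
    rw [this, mul_le_mul_iff_right₀ (by positivity)]
  rw [hset]; exact hz

/-! ### Part 4: discretization -/

theorem geom_two (a : ℝ) (ha : 2 ≤ a) (n : ℕ) : ∑ k ∈ Finset.range (n + 1), a ^ k ≤ 2 * a ^ n := by
  induction n with
  | zero => simp
  | succ n ih =>
    rw [Finset.sum_range_succ]
    have : 0 ≤ a ^ n := by positivity
    have h2 : a ^ (n + 1) = a * a ^ n := by ring
    nlinarith

theorem two_pow_rpow (p : ℝ) (k : ℕ) : ((2 : ℝ) ^ k) ^ p = ((2 : ℝ) ^ p) ^ k := by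
  rw [← Real.rpow_natCast, ← Real.rpow_natCast, ← Real.rpow_mul (by norm_num),
    ← Real.rpow_mul (by norm_num), mul_comm]

theorem layer_up (p : ℝ) (hp : 2 < p) (J : ℕ) : ∀ y : ℝ, 0 ≤ y → y ≤ 2 ^ J →
    y ^ p ≤ ((2 : ℝ) ^ p)⁻¹ +
      ∑ k ∈ Finset.range (J + 1), ((2 : ℝ) ^ p) ^ k * (if (2 : ℝ) ^ k ≤ 2 * y then 1 else 0) := by
  have ha : (0 : ℝ) < 2 ^ p := by positivity
  induction J with
  | zero =>
    intro y hy h1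
    simp only [zero_add, Finset.sum_range_one, pow_zero, one_mul]
    split_ifs with h
    · have : y ^ p ≤ 1 := Real.rpow_le_one hy (by simpa using h1) (by linarith)
      have : 0 < ((2 : ℝ) ^ p)⁻¹ := by positivity
      linarith
    · push Not at h
      rw [add_zero, ← Real.inv_rpow (by norm_num)]
      exact Real.rpow_le_rpow hy (by linarith) (by linarith)
  | succ J ih =>
    intro y hy h1
    rw [Finset.sum_range_succ]
    by_cases h : y ≤ 2 ^ J
    · have := ih y hy h
      have h2 : 0 ≤ ((2 : ℝ) ^ p) ^ (J + 1) * (if (2 : ℝ) ^ (J + 1) ≤ 2 * y then 1 else 0) := by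
        split_ifs <;> positivity
      linarith
    · push Not at h
      rw [if_pos (by rw [pow_succ]; linarith)]
      have h3 : y ^ p ≤ ((2 : ℝ) ^ p) ^ (J + 1) := by
        rw [← two_pow_rpow]
        exact Real.rpow_le_rpow hy h1 (by linarith)
      have h4 : 0 ≤ ∑ k ∈ Finset.range (J + 1),
          ((2 : ℝ) ^ p) ^ k * (if (2 : ℝ) ^ k ≤ 2 * y then 1 else 0) :=
        Finset.sum_nonneg fun k _ => by split_ifs <;> positivity
      have : 0 < ((2 : ℝ) ^ p)⁻¹ := by positivity
      linarith

theorem layer_down (p : ℝ) (hp : 2 < p) (n : ℕ) (y : ℝ) (hy : 0 ≤ y) :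
    ∑ k ∈ Finset.range n, ((2 : ℝ) ^ p) ^ k * (if (2 : ℝ) ^ k ≤ 4 * y then 1 else 0)
      ≤ 2 * (4 : ℝ) ^ p * y ^ p := by
  have h2a : (2 : ℝ) ≤ 2 ^ p := by
    conv_lhs => rw [← Real.rpow_one 2]
    exact Real.rpow_le_rpow_of_exponent_le (by norm_num) (by linarith)
  induction n with
  | zero => simp; positivity
  | succ n ih =>
    by_cases h : (2 : ℝ) ^ n ≤ 4 * y
    · calc _ ≤ ∑ k ∈ Finset.range (n + 1), ((2 : ℝ) ^ p) ^ k := by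
            refine Finset.sum_le_sum fun k _ => ?_
            have : 0 ≤ ((2 : ℝ) ^ p) ^ k := by positivity
            split_ifs <;> simp [this]
        _ ≤ 2 * ((2 : ℝ) ^ p) ^ n := geom_two _ h2a n
        _ ≤ 2 * (4 * y) ^ p := by
            rw [← two_pow_rpow]
            have := Real.rpow_le_rpow (by positivity) h (by linarith : 0 ≤ p)
            linarith
        _ = _ := by rw [Real.mul_rpow (by norm_num) hy]; ring
    · rw [Finset.sum_range_succ, if_neg h, mul_zero, add_zero]; exact ih

theorem lp_bdd_integrable {X : Type*} [MeasurableSpace X] (μ : Measure X) [IsFiniteMeasure μ]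
    (f : X → ℂ) (hf : Measurable f) (p : ℝ) (hp : 0 ≤ p) (M : ℝ) (hM : ∀ x, ‖f x‖ ≤ M) :
    Integrable (fun x => ‖f x‖ ^ p) μ := by
  refine Integrable.of_bound (C := M ^ p) (hf.norm.pow_const p).aestronglyMeasurable ?_
  refine Filter.Eventually.of_forall fun x => ?_
  rw [Real.norm_eq_abs, abs_of_nonneg (by positivity)]
  exact Real.rpow_le_rpow (norm_nonneg _) (hM x) hp

theorem disc_core {X : Type*} [MeasurableSpace X] (μ : Measure X) [IsProbabilityMeasure μ]
    (p : ℝ) (hp : 2 < p) (J : ℕ) (f : X → ℂ) (hf : Measurable f) (hfJ : ∀ x, ‖f x‖ ≤ 2 ^ J)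
    {m : ℕ} (ξ : Fin m → X) (e : ℕ → ℝ)
    (h : ∀ k ∈ Finset.range (J + 1), μ.real {x | (2 : ℝ) ^ k ≤ 2 * ‖f x‖}
      ≤ 4 * emp ξ {x | (2 : ℝ) ^ k ≤ 4 * ‖f x‖} + e k) :
    ∫ x, ‖f x‖ ^ p ∂μ ≤ ((2 : ℝ) ^ p)⁻¹ + 8 * (4 : ℝ) ^ p * ((m : ℝ)⁻¹ * ∑ j, ‖f (ξ j)‖ ^ p)
      + ∑ k ∈ Finset.range (J + 1), ((2 : ℝ) ^ p) ^ k * e k := by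
  have hms : ∀ k : ℕ, MeasurableSet {x | (2 : ℝ) ^ k ≤ 2 * ‖f x‖} := fun k =>
    measurableSet_le measurable_const (hf.norm.const_mul 2)
  have hii : ∀ k : ℕ, Integrable
      (fun x => ((2 : ℝ) ^ p) ^ k * ({x | (2 : ℝ) ^ k ≤ 2 * ‖f x‖}.indicator (fun _ => (1 : ℝ)) x)) μ := by
    intro k
    exact ((integrable_const (1 : ℝ)).indicator (hms k)).const_mul _
  have h1 : ∫ x, ‖f x‖ ^ p ∂μ ≤ ((2 : ℝ) ^ p)⁻¹ + ∑ k ∈ Finset.range (J + 1),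
      ((2 : ℝ) ^ p) ^ k * μ.real {x | (2 : ℝ) ^ k ≤ 2 * ‖f x‖} := by
    calc ∫ x, ‖f x‖ ^ p ∂μ ≤ ∫ x, (((2 : ℝ) ^ p)⁻¹ + ∑ k ∈ Finset.range (J + 1),
          ((2 : ℝ) ^ p) ^ k * ({x | (2 : ℝ) ^ k ≤ 2 * ‖f x‖}.indicator (fun _ => (1 : ℝ)) x)) ∂μ := by
          refine integral_mono (lp_bdd_integrable μ f hf p (by linarith) _ hfJ) ?_ ?_
          · exact (integrable_const _).add (integrable_finset_sum _ fun k _ => hii k)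
          · intro x
            have := layer_up p hp J ‖f x‖ (norm_nonneg _) (hfJ x)
            simpa [Set.indicator_apply] using this
      _ = _ := by
          rw [integral_add (integrable_const _) (integrable_finset_sum _ fun k _ => hii k),
            integral_finset_sum _ fun k _ => hii k]
          simp only [integral_const, probReal_univ, one_smul]
          congr 1
          refine Finset.sum_congr rfl fun k _ => ?_
          rw [integral_const_mul, integral_indicator_const _ (hms k)]
          simp
  have h2 : ∑ k ∈ Finset.range (J + 1), ((2 : ℝ) ^ p) ^ k * emp ξ {x | (2 : ℝ) ^ k ≤ 4 * ‖f x‖}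
      ≤ 2 * (4 : ℝ) ^ p * ((m : ℝ)⁻¹ * ∑ j, ‖f (ξ j)‖ ^ p) := by
    have e1 : ∑ k ∈ Finset.range (J + 1), ((2 : ℝ) ^ p) ^ k * emp ξ {x | (2 : ℝ) ^ k ≤ 4 * ‖f x‖}
        = (m : ℝ)⁻¹ * ∑ j, ∑ k ∈ Finset.range (J + 1),
          ((2 : ℝ) ^ p) ^ k * (if (2 : ℝ) ^ k ≤ 4 * ‖f (ξ j)‖ then 1 else 0) := by
      rw [Finset.sum_comm, Finset.mul_sum]
      refine Finset.sum_congr rfl fun k _ => ?_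
      rw [emp, ← Finset.mul_sum]
      simp only [Set.indicator_apply, Set.mem_setOf_eq]
      ring
    rw [e1]
    calc _ ≤ (m : ℝ)⁻¹ * ∑ j, 2 * (4 : ℝ) ^ p * ‖f (ξ j)‖ ^ p := by
          refine mul_le_mul_of_nonneg_left ?_ (by positivity)
          exact Finset.sum_le_sum fun j _ => layer_down p hp _ _ (norm_nonneg _)
      _ = _ := by rw [← Finset.mul_sum]; ring
  have h3 : ∑ k ∈ Finset.range (J + 1), ((2 : ℝ) ^ p) ^ k * μ.real {x | (2 : ℝ) ^ k ≤ 2 * ‖f x‖}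
      ≤ 4 * (∑ k ∈ Finset.range (J + 1), ((2 : ℝ) ^ p) ^ k * emp ξ {x | (2 : ℝ) ^ k ≤ 4 * ‖f x‖})
        + ∑ k ∈ Finset.range (J + 1), ((2 : ℝ) ^ p) ^ k * e k := by
    rw [Finset.mul_sum, ← Finset.sum_add_distrib]
    refine Finset.sum_le_sum fun k hk => ?_
    have := mul_le_mul_of_nonneg_left (h k hk) (by positivity : 0 ≤ ((2 : ℝ) ^ p) ^ k)
    linarith
  linarith

theorem emp_mono_union {X : Type*} {m : ℕ} (ξ : Fin m → X) (A B C : Set X) (h : A ⊆ B ∪ C) :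
    emp ξ A ≤ emp ξ B + emp ξ C := by
  unfold emp
  rw [← mul_add, ← Finset.sum_add_distrib]
  refine mul_le_mul_of_nonneg_left (Finset.sum_le_sum fun j _ => ?_) (by positivity)
  by_cases hA : ξ j ∈ A
  · rcases h hA with hB | hC
    · by_cases hC : ξ j ∈ C <;> simp [hA, hB, hC]
    · by_cases hB : ξ j ∈ B <;> simp [hA, hB, hC]
  · by_cases hB : ξ j ∈ B <;> by_cases hC : ξ j ∈ C <;> simp [hA, hB, hC]

/-- The empirical measure. -/
def muE {X : Type*} [MeasurableSpace X] {m : ℕ} (ξ : Fin m → X) : Measure X :=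
  ((m : ℝ≥0∞)⁻¹) • ∑ j, Measure.dirac (ξ j)

theorem muE_real {X : Type*} [MeasurableSpace X] {m : ℕ} (ξ : Fin m → X)
    (E : Set X) (hE : MeasurableSet E) : (muE ξ).real E = emp ξ E := by
  simp only [Measure.real, muE, Measure.smul_apply, Measure.finset_sum_apply, smul_eq_mul,
    ENNReal.toReal_mul, emp, ENNReal.toReal_inv, ENNReal.toReal_natCast]
  rw [ENNReal.toReal_sum]
  · congr 1
    refine Finset.sum_congr rfl fun j _ => ?_
    rw [Measure.dirac_apply' _ hE]
    by_cases h : ξ j ∈ E <;> simp [h]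
  · intro j _; exact measure_ne_top _ _

theorem muE_fin {X : Type*} [MeasurableSpace X] {m : ℕ} (hm : 0 < m) (ξ : Fin m → X) :
    IsFiniteMeasure (muE ξ) := by
  unfold muE
  refine ⟨?_⟩
  simp only [Measure.smul_apply, Measure.finset_sum_apply, smul_eq_mul]
  refine ENNReal.mul_lt_top ?_ ?_
  · rw [ENNReal.inv_lt_top]; exact_mod_cast hm
  · exact ENNReal.sum_lt_top.mpr fun j _ => measure_lt_top _ _

theorem hnet_meas {X : Type*} [MeasurableSpace X] {N : ℕ} (g : Fin N → X → ℂ)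
    (hgm : ∀ i, Measurable (g i)) (K : ℝ) (n : ℕ) (z : Fin n → Fin N × Fin 5) :
    Measurable (hnet g K n z) := by
  unfold hnet
  refine Measurable.const_mul ?_ _
  refine Finset.measurable_sum _ fun j _ => (hgm _).const_mul _

theorem disc_net {X : Type*} [MeasurableSpace X] (μ : Measure X) [IsProbabilityMeasure μ]
    {N : ℕ} (hN : 0 < N) (g : Fin N → X → ℂ) (hgm : ∀ i, Measurable (g i))
    (hg : ∀ i x, ‖g i x‖ ≤ 1) (J : ℕ) (c : Fin N → ℂ) (hc : ∑ i, ‖c i‖ ≤ 2 ^ J)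
    {m : ℕ} (hm : 0 < m) (ξ : Fin m → X) (k : ℕ) (n : ℕ) (hn : 0 < n) (L δ : ℝ)
    (hL : L ≤ n * ((2 : ℝ) ^ k / (32 * 2 ^ J)) ^ 2 / 16)
    (h : ∀ z : Fin n → Fin N × Fin 5,
      μ.real {x | 3 * (2 : ℝ) ^ k ≤ 8 * ‖hnet g (2 ^ J) n z x‖}
        ≤ 4 * emp ξ {x | 3 * (2 : ℝ) ^ k ≤ 8 * ‖hnet g (2 ^ J) n z x‖} + δ) :
    μ.real {x | (2 : ℝ) ^ k ≤ 2 * ‖∑ i, c i * g i x‖}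
      ≤ 4 * emp ξ {x | (2 : ℝ) ^ k ≤ 4 * ‖∑ i, c i * g i x‖} + (δ + 40 * Real.exp (-L)) := by
  have := muE_fin hm ξ
  obtain ⟨z, hz⟩ := net_approx (μ + muE ξ) hN g hgm hg c (2 ^ J) (by positivity) hc n hn
    ((2 : ℝ) ^ k / (32 * 2 ^ J)) (by positivity)
  have e4 : 4 * (2 : ℝ) ^ J * (2 ^ k / (32 * 2 ^ J)) = 2 ^ k / 8 := by field_simp; norm_num
  rw [e4] at hz
  set f : X → ℂ := fun x => ∑ i, c i * g i x with hf
  have hfm : Measurable f := Finset.measurable_sum _ fun j _ => (hgm _).const_mul _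
  set hh := hnet g (2 ^ J) n z with hhd
  have hhm : Measurable hh := hnet_meas g hgm _ n z
  set Bad : Set X := {x | (2 : ℝ) ^ k / 8 ≤ ‖f x - hh x‖} with hBad
  have hBm : MeasurableSet Bad := measurableSet_le measurable_const (hfm.sub hhm).norm
  have hsum : (μ + muE ξ).real Bad = μ.real Bad + emp ξ Bad := by
    rw [measureReal_add_apply, muE_real ξ _ hBm]
  have hun : (μ + muE ξ).real Set.univ = 2 := by
    rw [measureReal_add_apply, muE_real ξ _ MeasurableSet.univ, probReal_univ]
    have : (m : ℝ) ≠ 0 := by exact_mod_cast hm.ne'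
    simp [emp, this]; norm_num
  have hz2 : (μ + muE ξ).real Bad ≤ 4 * Real.exp (-(n * (2 ^ k / (32 * 2 ^ J)) ^ 2 / 16)) *
      (μ + muE ξ).real Set.univ := hz
  rw [hsum, hun] at hz2
  have hexp : Real.exp (-(n * ((2 : ℝ) ^ k / (32 * 2 ^ J)) ^ 2 / 16)) ≤ Real.exp (-L) :=
    Real.exp_le_exp.mpr (by linarith)
  have hm0 : 0 ≤ μ.real Bad := measureReal_nonneg
  have he0 : 0 ≤ emp ξ Bad := by rw [← muE_real ξ _ hBm]; exact measureReal_nonneg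
  have hz' := h z
  have s1 : {x | (2 : ℝ) ^ k ≤ 2 * ‖f x‖} ⊆ {x | 3 * (2 : ℝ) ^ k ≤ 8 * ‖hh x‖} ∪ Bad := by
    intro x hx
    by_cases hb : x ∈ Bad
    · exact Or.inr hb
    · left
      simp only [hBad, Set.mem_setOf_eq, not_le] at hb hx ⊢
      have := norm_sub_norm_le (f x) (hh x)
      linarith
  have s2 : {x | 3 * (2 : ℝ) ^ k ≤ 8 * ‖hh x‖} ⊆ {x | (2 : ℝ) ^ k ≤ 4 * ‖f x‖} ∪ Bad := by
    intro x hx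
    by_cases hb : x ∈ Bad
    · exact Or.inr hb
    · left
      simp only [hBad, Set.mem_setOf_eq, not_le] at hb hx ⊢
      have := norm_sub_norm_le (hh x) (f x)
      rw [norm_sub_rev] at this
      linarith
  have i1 := (measureReal_mono s1 (measure_ne_top μ _)).trans (measureReal_union_le _ _)
  have i2 := emp_mono_union ξ _ _ _ s2
  change μ.real {x | (2 : ℝ) ^ k ≤ 2 * ‖f x‖} ≤ 4 * emp ξ {x | (2 : ℝ) ^ k ≤ 4 * ‖f x‖} + _
  linarith

theorem disc_select {X : Type*} [MeasurableSpace X] (μ : Measure X) [IsProbabilityMeasure μ]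
    {N : ℕ} (hN : 0 < N) (g : Fin N → X → ℂ) (hgm : ∀ i, Measurable (g i)) (K : ℝ)
    (J : ℕ) (n : ℕ → ℕ) (m : ℕ) (hm : 0 < m)
    (h : ∑ k ∈ Finset.range (J + 1), Real.exp (-(n k * Real.log (5 * N))) < 1) :
    ∃ ξ : Fin m → X, ∀ k ∈ Finset.range (J + 1), ∀ z : Fin (n k) → Fin N × Fin 5,
      μ.real {x | 3 * (2 : ℝ) ^ k ≤ 8 * ‖hnet g K (n k) z x‖}
        ≤ 4 * emp ξ {x | 3 * (2 : ℝ) ^ k ≤ 8 * ‖hnet g K (n k) z x‖}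
          + 8 * n k * Real.log (5 * N) / m := by
  have hmR : (0 : ℝ) < m := by exact_mod_cast hm
  let A := (k : Fin (J + 1)) × (Fin (n k) → Fin N × Fin 5)
  let E : A → Set X := fun a => {x | 3 * (2 : ℝ) ^ (a.1 : ℕ) ≤ 8 * ‖hnet g K (n a.1) a.2 x‖}
  let P : A → Prop := fun a => 8 * n a.1 * Real.log (5 * N) / m < μ.real (E a)
  have hEm : ∀ a : A, MeasurableSet (E a) := fun a =>
    measurableSet_le measurable_const ((hnet_meas g hgm K _ a.2).norm.const_mul 8)
  have hsum : ∑ a : {a : A // P a}, Real.exp (-(m * μ.real (E a.1) / 4)) < 1 := by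
    calc ∑ a : {a : A // P a}, Real.exp (-(m * μ.real (E a.1) / 4))
        ≤ ∑ a : {a : A // P a}, Real.exp (-(2 * (n a.1.1 * Real.log (5 * N)))) := by
          refine Finset.sum_le_sum fun a _ => Real.exp_le_exp.mpr ?_
          have := a.2
          simp only [P] at this
          rw [div_lt_iff₀ hmR] at this
          linarith
      _ ≤ ∑ a : A, Real.exp (-(2 * (n a.1 * Real.log (5 * N)))) := by
          have e := Finset.sum_map Finset.univ (Function.Embedding.subtype P)
            (fun a : A => Real.exp (-(2 * (n a.1 * Real.log (5 * N)))))
          refine (le_of_eq e.symm).trans ?_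
          exact Finset.sum_le_sum_of_subset_of_nonneg (Finset.subset_univ _)
            fun _ _ _ => (Real.exp_pos _).le
      _ = ∑ k : Fin (J + 1), Real.exp (-(n k * Real.log (5 * N))) := by
          rw [Fintype.sum_sigma]
          refine Finset.sum_congr rfl fun k _ => ?_
          simp only [Finset.sum_const, Finset.card_univ, nsmul_eq_mul]
          rw [Fintype.card_fun, Fintype.card_prod, Fintype.card_fin, Fintype.card_fin,
            Fintype.card_fin]
          have h5 : (((N * 5) ^ n k : ℕ) : ℝ) = Real.exp (n k * Real.log (5 * N)) := by
            have : (0 : ℝ) < 5 * N := by positivity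
            rw [mul_comm (n k : ℝ), ← Real.rpow_def_of_pos this, Real.rpow_natCast]
            push_cast; ring
          rw [h5, ← Real.exp_add]; congr 1; ring
      _ < 1 := by
          rw [Fin.sum_univ_eq_sum_range (fun k => Real.exp (-(n k * Real.log (5 * N)))) (J + 1)]
          exact h
  obtain ⟨ξ, hξ⟩ := sampling μ (fun a : {a : A // P a} => E a.1) (fun a => hEm a.1) m hm hsum
  refine ⟨ξ, fun k hk z => ?_⟩
  let a : A := ⟨⟨k, Finset.mem_range.mp hk⟩, z⟩
  change μ.real (E a) ≤ 4 * emp ξ (E a) + 8 * n k * Real.log (5 * N) / m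
  have hlog : 0 ≤ Real.log (5 * N) := Real.log_nonneg (by
    have : (1 : ℝ) ≤ N := by exact_mod_cast hN
    linarith)
  by_cases hP : P a
  · have := hξ ⟨a, hP⟩
    have : 0 ≤ 8 * n k * Real.log (5 * N) / m := by positivity
    linarith
  · have h1 : μ.real (E a) ≤ 8 * n k * Real.log (5 * N) / m := not_lt.mp hP
    have h0 : 0 ≤ emp ξ (E a) := by
      have := muE_fin hm ξ
      rw [← muE_real ξ _ (hEm a)]; exact measureReal_nonneg
    linarith

theorem geom_b (b : ℝ) (hb : 1 < b) (n : ℕ) :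
    ∑ k ∈ Finset.range (n + 1), b ^ k ≤ b / (b - 1) * b ^ n := by
  rw [geom_sum_eq hb.ne', div_mul_eq_mul_div]
  have : 0 < b - 1 := by linarith
  gcongr
  rw [pow_succ]; linarith

theorem disc_main {X : Type*} [MeasurableSpace X] (μ : Measure X) [IsProbabilityMeasure μ]
    {N : ℕ} (hN : 0 < N) (g : Fin N → X → ℂ) (hgm : ∀ i, Measurable (g i))
    (hg : ∀ i x, ‖g i x‖ ≤ 1) (p : ℝ) (hp : 2 < p) (J : ℕ) :
    ∃ (m : ℕ) (ξ : Fin m → X), 0 < m ∧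
      (m : ℝ) ≤ 64 * Real.log (5 * N) * (16384 * Real.log (640 * ((2 : ℝ) ^ p) ^ J) + 1)
        * ((2 : ℝ) ^ (p - 2) / ((2 : ℝ) ^ (p - 2) - 1)) * ((2 : ℝ) ^ p) ^ J + 1 ∧
      ∀ c : Fin N → ℂ, 0 < SamplingRecovery.lpNorm μ p (fun x => ∑ i, c i * g i x) →
        ∑ i, ‖c i‖ ≤ 2 ^ J * SamplingRecovery.lpNorm μ p (fun x => ∑ i, c i * g i x) →
        SamplingRecovery.lpNorm μ p (fun x => ∑ i, c i * g i x)
          ≤ 16 * dNorm ξ p (fun x => ∑ i, c i * g i x) := by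
  set a : ℝ := (2 : ℝ) ^ p with ha
  set b : ℝ := (2 : ℝ) ^ (p - 2) with hb
  have hab : a = 4 * b := by
    rw [ha, hb, Real.rpow_sub (by norm_num)]; norm_num; ring
  have hb1 : 1 < b := Real.one_lt_rpow (by norm_num) (by linarith)
  have ha4 : 4 < a := by linarith
  have haJ : 1 ≤ a ^ J := one_le_pow₀ (by linarith)
  set L : ℝ := Real.log (640 * a ^ J) with hL
  have hexpL : Real.exp (-L) = (640 * a ^ J)⁻¹ := by
    rw [Real.exp_neg, hL, Real.exp_log (by positivity)]
  have hLpos : 0 < L := Real.log_pos (by linarith)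
  set ns : ℕ := ⌈16384 * L⌉₊ with hns
  have hns1 : 16384 * L ≤ ns := Nat.le_ceil _
  have hns2 : (ns : ℝ) ≤ 16384 * L + 1 := (Nat.ceil_lt_add_one (by positivity)).le
  have hns0 : 0 < ns := Nat.ceil_pos.mpr (by positivity)
  have hnsR : (0 : ℝ) < ns := by exact_mod_cast hns0
  set M0 : ℝ := Real.log (5 * N) with hM0
  have hM1 : 1 ≤ M0 := by
    have h1 : (1 : ℝ) ≤ N := by exact_mod_cast hN
    rw [hM0, Real.le_log_iff_exp_le (by linarith)]
    have := Real.exp_one_lt_d9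
    linarith
  set B : ℝ := b / (b - 1) with hB
  have hB0 : 0 < B := div_pos (by linarith) (by linarith)
  set m : ℕ := ⌈64 * M0 * ns * B * a ^ J⌉₊ with hm
  have hmpos : 0 < m := Nat.ceil_pos.mpr (by positivity)
  have hmR : (0 : ℝ) < m := by exact_mod_cast hmpos
  have hm1 : 64 * M0 * ns * B * a ^ J ≤ m := Nat.le_ceil _
  have hm2 : (m : ℝ) ≤ 64 * M0 * ns * B * a ^ J + 1 := (Nat.ceil_lt_add_one (by positivity)).le
  set n : ℕ → ℕ := fun k => ns * 4 ^ (J - k) with hn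
  have hn0 : ∀ k, 0 < n k := fun k => by positivity
  have hnk : ∀ k, ns ≤ n k := fun k => Nat.le_mul_of_pos_right _ (by positivity)
  have hsel : ∑ k ∈ Finset.range (J + 1), Real.exp (-(n k * Real.log (5 * N))) < 1 := by
    calc _ ≤ ∑ k ∈ Finset.range (J + 1), Real.exp (-L) := by
          refine Finset.sum_le_sum fun k _ => Real.exp_le_exp.mpr ?_
          have : (ns : ℝ) ≤ n k := by exact_mod_cast hnk k
          nlinarith
      _ = (J + 1) * (640 * a ^ J)⁻¹ := by
          rw [hexpL]; simp
      _ < 1 := by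
          rw [← div_eq_mul_inv, div_lt_one (by positivity)]
          have : (J : ℝ) * (a - 1) + 1 ≤ a ^ J := by
            have := one_add_mul_sub_le_pow (a := a) (by linarith) J
            linarith
          have hJ : (0 : ℝ) ≤ J := by positivity
          nlinarith
  obtain ⟨ξ, hξ⟩ := disc_select μ hN g hgm (2 ^ J) J n m hmpos hsel
  refine ⟨m, ξ, hmpos, ?_, ?_⟩
  · refine hm2.trans ?_
    gcongr
  -- normalized statement
  have hnorm : ∀ c : Fin N → ℂ, ∑ i, ‖c i‖ ≤ 2 ^ J →
      ∫ x, ‖∑ i, c i * g i x‖ ^ p ∂μ ≤ 1 / 2 + 8 * (4 : ℝ) ^ p *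
        ((m : ℝ)⁻¹ * ∑ j, ‖∑ i, c i * g i (ξ j)‖ ^ p) := by
    intro c hc
    have hfm : Measurable (fun x => ∑ i, c i * g i x) :=
      Finset.measurable_sum _ fun j _ => (hgm _).const_mul _
    have hfJ : ∀ x, ‖∑ i, c i * g i x‖ ≤ 2 ^ J := by
      intro x
      refine (norm_sum_le _ _).trans (le_trans (Finset.sum_le_sum fun i _ => ?_) hc)
      rw [norm_mul]; exact mul_le_of_le_one_right (norm_nonneg _) (hg i x)
    have h1 := disc_core μ p hp J _ hfm hfJ ξ
      (fun k => 8 * n k * M0 / m + 40 * Real.exp (-L)) (fun k hk => by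
        have hkJ : k ≤ J := Nat.lt_succ_iff.mp (Finset.mem_range.mp hk)
        refine disc_net μ hN g hgm hg J c hc hmpos ξ k (n k) (hn0 k) L _ ?_ (hξ k hk)
        have e1 : (n k : ℝ) * (2 ^ k / (32 * 2 ^ J)) ^ 2 / 16 = ns / 16384 := by
          have e2 : (2 : ℝ) ^ J = 2 ^ k * 2 ^ (J - k) := by rw [← pow_add]; congr 1; omega
          have e3 : (4 : ℝ) ^ (J - k) = (2 ^ (J - k)) ^ 2 := by
            rw [← pow_mul, mul_comm, pow_mul]; norm_num
          simp only [hn]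
          push_cast
          rw [e2, e3]
          field_simp
          norm_num
        rw [e1]; linarith)
    have h2 : ∑ k ∈ Finset.range (J + 1), a ^ k * (8 * n k * M0 / m + 40 * Real.exp (-L))
        ≤ 1 / 4 := by
      have e1 : ∑ k ∈ Finset.range (J + 1), a ^ k * (8 * n k * M0 / m + 40 * Real.exp (-L))
          = 8 * ns * M0 / m * 4 ^ J * ∑ k ∈ Finset.range (J + 1), b ^ k
            + 40 * Real.exp (-L) * ∑ k ∈ Finset.range (J + 1), a ^ k := by
        rw [Finset.mul_sum, Finset.mul_sum, ← Finset.sum_add_distrib]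
        refine Finset.sum_congr rfl fun k hk => ?_
        have hkJ : k ≤ J := Nat.lt_succ_iff.mp (Finset.mem_range.mp hk)
        have e2 : (4 : ℝ) ^ J = 4 ^ k * 4 ^ (J - k) := by rw [← pow_add]; congr 1; omega
        have e3 : a ^ k = 4 ^ k * b ^ k := by rw [hab, mul_pow]
        simp only [hn]
        push_cast
        rw [e2, e3]; ring
      have e4 : 8 * ns * M0 / m * 4 ^ J * ∑ k ∈ Finset.range (J + 1), b ^ k ≤ 1 / 8 := by
        calc _ ≤ 8 * ns * M0 / m * 4 ^ J * (B * b ^ J) := by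
              gcongr; exact geom_b b hb1 J
          _ = (64 * M0 * ns * B * a ^ J) / m / 8 := by rw [hab, mul_pow]; ring
          _ ≤ 1 / 8 := by
              gcongr; rw [div_le_one hmR]; exact hm1
      have e5 : 40 * Real.exp (-L) * ∑ k ∈ Finset.range (J + 1), a ^ k ≤ 1 / 8 := by
        calc _ ≤ 40 * Real.exp (-L) * (2 * a ^ J) := by
              gcongr; exact geom_two a (by linarith) J
          _ = 1 / 8 := by rw [hexpL]; field_simp; norm_num
      rw [e1]; linarith
    have h3 : a⁻¹ ≤ 1 / 4 := by
      rw [one_div]; exact inv_anti₀ (by norm_num) ha4.le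
    linarith
  intro c hI hc
  set f : X → ℂ := fun x => ∑ i, c i * g i x with hf
  set I := SamplingRecovery.lpNorm μ p f with hIdef
  have hIp : ∫ x, ‖f x‖ ^ p ∂μ = I ^ p := by
    rw [hIdef, SamplingRecovery.lpNorm, ← Real.rpow_mul (integral_nonneg fun x => by positivity),
      one_div_mul_cancel (by linarith), Real.rpow_one]
  have hIpp : 0 < I ^ p := by positivity
  have hinv : ‖((I⁻¹ : ℝ) : ℂ)‖ = I⁻¹ := by
    rw [Complex.norm_real, Real.norm_eq_abs, abs_of_pos (by positivity)]
  have hpt : ∀ x, ‖∑ i, ((I⁻¹ : ℝ) : ℂ) * c i * g i x‖ ^ p = (I ^ p)⁻¹ * ‖f x‖ ^ p := by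
    intro x
    have : ∑ i, ((I⁻¹ : ℝ) : ℂ) * c i * g i x = ((I⁻¹ : ℝ) : ℂ) * f x := by
      rw [hf, Finset.mul_sum]; simp only [mul_assoc]
    rw [this, norm_mul, hinv, Real.mul_rpow (by positivity) (by positivity),
      Real.inv_rpow hI.le]
  have h1 := hnorm (fun i => ((I⁻¹ : ℝ) : ℂ) * c i) (by
    simp only [norm_mul, hinv]
    rw [← Finset.mul_sum, inv_mul_le_iff₀ hI]; linarith)
  simp only [hpt] at h1
  rw [integral_const_mul, hIp, inv_mul_cancel₀ hIpp.ne', ← Finset.mul_sum] at h1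
  set D := dNorm ξ p f with hD
  have hDp : (m : ℝ)⁻¹ * ∑ j, ‖f (ξ j)‖ ^ p = D ^ p := (dNorm_rpow ξ p (by linarith) f).symm
  have e1 : (m : ℝ)⁻¹ * ((I ^ p)⁻¹ * ∑ j, ‖f (ξ j)‖ ^ p) = (I ^ p)⁻¹ * D ^ p := by
    rw [← hDp]; ring
  rw [e1] at h1
  have hD0 : 0 ≤ D := dNorm_nonneg _ _ _
  have h16 : (16 : ℝ) * 4 ^ p ≤ 16 ^ p := by
    have : (16 : ℝ) ^ p = 4 ^ p * 4 ^ p := by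
      rw [← Real.mul_rpow (by norm_num) (by norm_num)]; norm_num
    rw [this]
    have h4 : (16 : ℝ) ≤ 4 ^ p := by
      have : (4 : ℝ) ^ (2 : ℝ) ≤ 4 ^ p :=
        Real.rpow_le_rpow_of_exponent_le (by norm_num) hp.le
      norm_num at this; exact this
    gcongr
  have h2 : I ^ p ≤ (16 * D) ^ p := by
    rw [Real.mul_rpow (by norm_num) hD0]
    have h3 : 1 ≤ 16 * (4 : ℝ) ^ p * ((I ^ p)⁻¹ * D ^ p) := by linarith
    have h4 : I ^ p ≤ 16 * (4 : ℝ) ^ p * D ^ p := by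
      have := mul_le_mul_of_nonneg_left h3 hIpp.le
      have e : I ^ p * (16 * (4 : ℝ) ^ p * ((I ^ p)⁻¹ * D ^ p)) = 16 * (4 : ℝ) ^ p * D ^ p := by
        field_simp
      linarith
    have : 0 ≤ D ^ p := by positivity
    nlinarith
  exact (Real.rpow_le_rpow_iff hI.le (by positivity) (by linarith)).mp h2

theorem lp_rpow {X : Type*} [MeasurableSpace X] (μ : Measure X) (p : ℝ) (hp : 0 < p) (f : X → ℂ) :
    (SamplingRecovery.lpNorm μ p f) ^ p = ∫ x, ‖f x‖ ^ p ∂μ := by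
  rw [SamplingRecovery.lpNorm, ← Real.rpow_mul (integral_nonneg fun x => by positivity),
      one_div_mul_cancel hp.ne', Real.rpow_one]

theorem lp_nonneg {X : Type*} [MeasurableSpace X] (μ : Measure X) (p : ℝ) (f : X → ℂ) :
    0 ≤ SamplingRecovery.lpNorm μ p f :=
  Real.rpow_nonneg (integral_nonneg fun x => by positivity) _

theorem lp2_le {X : Type*} [MeasurableSpace X] (μ : Measure X) [IsProbabilityMeasure μ]
    (f : X → ℂ) (hf : Measurable f) (p : ℝ) (hp : 2 < p) (M : ℝ) (hM : ∀ x, ‖f x‖ ≤ M) :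
    SamplingRecovery.lpNorm μ 2 f ≤ SamplingRecovery.lpNorm μ p f := by
  have hcv := convexOn_rpow (p := p / 2) (by linarith)
  have hpp : ∀ x, (‖f x‖ ^ (2 : ℝ)) ^ (p / 2) = ‖f x‖ ^ p := by
    intro x; rw [← Real.rpow_mul (norm_nonneg _)]; congr 1; ring
  have h := hcv.map_integral_le (μ := μ) (f := fun x => ‖f x‖ ^ (2 : ℝ))
    (fun x _ => (Real.continuousAt_rpow_const _ _ (Or.inr (by linarith))).continuousWithinAt)
    isClosed_Ici
    (Filter.Eventually.of_forall fun x => by simp only [Set.mem_Ici]; positivity)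
    (lp_bdd_integrable μ f hf 2 (by norm_num) M hM)
    (by
      have := lp_bdd_integrable μ f hf p (by linarith) M hM
      refine this.congr (Filter.Eventually.of_forall fun x => ?_)
      simp only [Function.comp]; rw [hpp])
  simp only [hpp] at h
  have h2 := lp_rpow μ 2 (by norm_num) f
  rw [← h2, ← lp_rpow μ p (by linarith), ← Real.rpow_mul (lp_nonneg _ _ _)] at h
  have e : 2 * (p / 2) = p := by ring
  rw [e] at h
  exact (Real.rpow_le_rpow_iff (lp_nonneg _ _ _) (lp_nonneg _ _ _) (by linarith)).mp h

theorem lp_add_sup {X : Type*} [MeasurableSpace X] (μ : Measure X) [IsProbabilityMeasure μ]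
    (F H : X → ℂ) (hH : Measurable H) (p : ℝ) (hp : 2 < p) (M : ℝ) (hM : ∀ x, ‖H x‖ ≤ M)
    (s : ℝ) (hs : 0 ≤ s) (hF : ∀ x, ‖F x‖ ≤ s) :
    SamplingRecovery.lpNorm μ p (F + H) ≤ 2 * (s + SamplingRecovery.lpNorm μ p H) := by
  have hp0 : 0 < p := by linarith
  have hI := lp_nonneg μ p H
  set I := SamplingRecovery.lpNorm μ p H with hIdef
  have hHi := lp_bdd_integrable μ H hH p hp0.le M hM
  refine (Real.rpow_le_rpow_iff (lp_nonneg _ _ _) (by positivity) hp0).mp ?_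
  rw [lp_rpow μ p hp0]
  calc ∫ x, ‖(F + H) x‖ ^ p ∂μ ≤ ∫ x, (2 : ℝ) ^ p * (s ^ p + ‖H x‖ ^ p) ∂μ := by
        refine integral_mono_of_nonneg (Filter.Eventually.of_forall fun x => by positivity) ?_ ?_
        · exact ((integrable_const _).add hHi).const_mul _
        · refine Filter.Eventually.of_forall fun x => ?_
          have h1 : ‖(F + H) x‖ ≤ 2 * max s ‖H x‖ := by
            have := norm_add_le (F x) (H x)
            have := le_max_left s ‖H x‖
            have := le_max_right s ‖H x‖
            have := hF x
            simp only [Pi.add_apply]; linarith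
          have h2 := Real.rpow_le_rpow (norm_nonneg _) h1 hp0.le
          refine h2.trans ?_
          rw [Real.mul_rpow (by norm_num) (le_max_of_le_left hs)]
          have h3 : (max s ‖H x‖) ^ p ≤ s ^ p + ‖H x‖ ^ p := by
            have : 0 ≤ s ^ p := by positivity
            have : 0 ≤ ‖H x‖ ^ p := by positivity
            rcases max_choice s ‖H x‖ with h | h <;> rw [h] <;> linarith
          exact mul_le_mul_of_nonneg_left h3 (by positivity)
    _ = (2 : ℝ) ^ p * (s ^ p + I ^ p) := by
        rw [integral_const_mul, integral_add (integrable_const _) hHi, ← lp_rpow μ p hp0]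
        simp [hIdef]
    _ ≤ (2 * (s + I)) ^ p := by
        rw [Real.mul_rpow (by norm_num) (by positivity)]
        gcongr
        exact Real.add_rpow_le_rpow_add hs hI (by linarith)

/-- constant in the bound for the number of points -/
def CcD (p R1 : ℝ) : ℝ :=
  320 * (16384 * (639 + 4 * p / R1 + p) + 1) * ((2 : ℝ) ^ (p - 2) / ((2 : ℝ) ^ (p - 2) - 1))
    * (2 * Real.sqrt 2 / R1) ^ p + 1

theorem disc_riesz {X : Type*} [MeasurableSpace X] (μ : Measure X) [IsProbabilityMeasure μ]
    {N : ℕ} (g : Fin N → X → ℂ) (hgm : ∀ i, Measurable (g i))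
    (hg : ∀ i x, ‖g i x‖ ≤ 1) (p : ℝ) (hp : 2 < p) (R1 : ℝ) (hR : 0 < R1) (hR1 : R1 ≤ 1)
    (hz : ∀ a : Fin N → ℂ, R1 * (∑ j, ‖a j‖ ^ 2) ^ (1 / 2 : ℝ) ≤
      SamplingRecovery.lpNorm μ 2 (fun x => ∑ j, a j * g j x))
    (u : ℕ) (hu : 0 < u) (huN : u ≤ N) (hlog : 1 ≤ Real.log N) :
    ∃ (m : ℕ) (ξ : Fin m → X), 0 < m ∧
      (m : ℝ) ≤ CcD p R1 * (u : ℝ) ^ (p / 2) * (Real.log N) ^ 2 ∧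
      ∀ (B : Finset (Fin N)) (c : Fin N → ℂ), B.card ≤ 2 * u →
        SamplingRecovery.lpNorm μ p (fun x => ∑ i ∈ B, c i * g i x)
          ≤ 16 * dNorm ξ p (fun x => ∑ i ∈ B, c i * g i x) ∧
        l2 c B ≤ R1⁻¹ * SamplingRecovery.lpNorm μ p (fun x => ∑ i ∈ B, c i * g i x) := by
  have hN : 0 < N := by omega
  have huR : (1 : ℝ) ≤ u := by exact_mod_cast hu
  have huNR : (u : ℝ) ≤ N := by exact_mod_cast huN
  set w : ℝ := Real.sqrt (2 * u) / R1 with hw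
  have hw1 : 1 ≤ w := by
    rw [hw, one_le_div hR]
    refine hR1.trans (Real.one_le_sqrt.mpr (by linarith))
  obtain ⟨n0, hn1, hn2⟩ := exists_nat_pow_near hw1 (by norm_num : (1 : ℝ) < 2)
  set J := n0 + 1 with hJ
  have hJ2 : (2 : ℝ) ^ J ≤ 2 * w := by rw [hJ, pow_succ]; linarith
  obtain ⟨m, ξ, hm, hmb, hdisc⟩ := disc_main μ hN g hgm hg p hp J
  refine ⟨m, ξ, hm, ?_, ?_⟩
  · set ℓ := Real.log N with hℓ
    have hsq : Real.sqrt (2 * u) = Real.sqrt 2 * Real.sqrt u := Real.sqrt_mul (by norm_num) _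
    have haJ : ((2 : ℝ) ^ p) ^ J ≤ (2 * Real.sqrt 2 / R1) ^ p * (u : ℝ) ^ (p / 2) := by
      rw [← two_pow_rpow]
      have e : (u : ℝ) ^ (p / 2) = (Real.sqrt u) ^ p := by
        rw [Real.sqrt_eq_rpow, ← Real.rpow_mul (by positivity)]; congr 1; ring
      rw [e, ← Real.mul_rpow (by positivity) (by positivity)]
      refine Real.rpow_le_rpow (by positivity) (hJ2.trans (le_of_eq ?_)) (by linarith)
      rw [hw, hsq]; ring
    have hNR : (1 : ℝ) ≤ N := huR.trans huNR
    have hs2 : Real.sqrt (2 * u) ≤ 2 * N / 1 := by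
      rw [Real.sqrt_le_left (by positivity)]
      nlinarith
    have h2J : (2 : ℝ) ^ J ≤ 4 / R1 * N := by
      refine hJ2.trans ?_
      rw [hw]
      have : Real.sqrt (2 * u) / R1 ≤ (2 * N / 1) / R1 := by gcongr
      calc _ ≤ 2 * ((2 * N / 1) / R1) := by linarith
        _ = _ := by ring
    have hL : Real.log (640 * ((2 : ℝ) ^ p) ^ J) ≤ (639 + 4 * p / R1 + p) * ℓ := by
      rw [← two_pow_rpow, Real.log_mul (by norm_num) (by positivity), Real.log_rpow (by positivity)]
      have l1 := Real.log_le_sub_one_of_pos (by norm_num : (0 : ℝ) < 640)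
      have l2 : Real.log ((2 : ℝ) ^ J) ≤ 4 / R1 + ℓ := by
        refine (Real.log_le_log (by positivity) h2J).trans ?_
        rw [Real.log_mul (by positivity) (by positivity)]
        have := Real.log_le_sub_one_of_pos (by positivity : 0 < 4 / R1)
        linarith
      have l3 : 0 ≤ 639 + 4 * p / R1 := by positivity
      have l4 : p * Real.log ((2 : ℝ) ^ J) ≤ p * (4 / R1 + ℓ) :=
        mul_le_mul_of_nonneg_left l2 (by linarith)
      have l5 : p * (4 / R1 + ℓ) = 4 * p / R1 + p * ℓ := by ring
      nlinarith
    have hM0 : Real.log (5 * N) ≤ 5 * ℓ := by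
      rw [Real.log_mul (by norm_num) (by positivity)]
      have := Real.log_le_sub_one_of_pos (by norm_num : (0 : ℝ) < 5)
      linarith
    have hb1 : 1 < (2 : ℝ) ^ (p - 2) := Real.one_lt_rpow (by norm_num) (by linarith)
    have hB0 : 0 < (2 : ℝ) ^ (p - 2) / ((2 : ℝ) ^ (p - 2) - 1) :=
      div_pos (by linarith) (by linarith)
    have hu2 : 1 ≤ (u : ℝ) ^ (p / 2) := Real.one_le_rpow huR (by linarith)
    have hM00 : 0 ≤ Real.log (5 * N) := Real.log_nonneg (by linarith)
    have hL0 : 0 ≤ Real.log (640 * ((2 : ℝ) ^ p) ^ J) := by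
      apply Real.log_nonneg
      have : 1 ≤ ((2 : ℝ) ^ p) ^ J := one_le_pow₀ (Real.one_le_rpow (by norm_num) (by linarith))
      linarith
    set C1 := 639 + 4 * p / R1 + p with hC1
    have hC10 : 0 < C1 := by positivity
    set B := (2 : ℝ) ^ (p - 2) / ((2 : ℝ) ^ (p - 2) - 1) with hB
    calc (m : ℝ) ≤ 64 * Real.log (5 * N) * (16384 * Real.log (640 * ((2 : ℝ) ^ p) ^ J) + 1)
        * B * ((2 : ℝ) ^ p) ^ J + 1 := hmb
      _ ≤ 64 * (5 * ℓ) * (16384 * (C1 * ℓ) + ℓ) * B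
          * ((2 * Real.sqrt 2 / R1) ^ p * (u : ℝ) ^ (p / 2)) + (u : ℝ) ^ (p / 2) * ℓ ^ 2 := by
          have : 1 ≤ (u : ℝ) ^ (p / 2) * ℓ ^ 2 := one_le_mul_of_one_le_of_one_le hu2
            (one_le_pow₀ hlog)
          gcongr
      _ = _ := by rw [CcD]; ring
  · intro B c hB
    set c' : Fin N → ℂ := fun i => if i ∈ B then c i else 0 with hc'
    have hfe : (fun x => ∑ i ∈ B, c i * g i x) = fun x => ∑ i, c' i * g i x := by
      funext x
      simp only [hc', ite_mul, zero_mul]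
      rw [Finset.sum_ite_mem, Finset.univ_inter]
    have hl2 : (∑ j, ‖c' j‖ ^ 2) ^ (1 / 2 : ℝ) = l2 c B := by
      rw [l2, Real.sqrt_eq_rpow]
      congr 1
      have : ∀ j, ‖c' j‖ ^ 2 = if j ∈ B then ‖c j‖ ^ 2 else 0 := by
        intro j; simp only [hc']; split_ifs <;> simp
      simp only [this]
      rw [Finset.sum_ite_mem, Finset.univ_inter]
    have hl1 : ∑ j, ‖c' j‖ = ∑ j ∈ B, ‖c j‖ := by
      have : ∀ j, ‖c' j‖ = if j ∈ B then ‖c j‖ else 0 := by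
        intro j; simp only [hc']; split_ifs <;> simp
      simp only [this]
      rw [Finset.sum_ite_mem, Finset.univ_inter]
    rw [hfe]
    have hfm : Measurable (fun x => ∑ i, c' i * g i x) :=
      Finset.measurable_sum _ fun j _ => (hgm _).const_mul _
    have hfJ : ∀ x, ‖∑ i, c' i * g i x‖ ≤ ∑ i, ‖c' i‖ := by
      intro x
      refine (norm_sum_le _ _).trans (Finset.sum_le_sum fun i _ => ?_)
      rw [norm_mul]; exact mul_le_of_le_one_right (norm_nonneg _) (hg i x)
    have h2 := (hz c').trans (lp2_le μ _ hfm p hp _ hfJ)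
    rw [hl2] at h2
    set I := SamplingRecovery.lpNorm μ p (fun x => ∑ i, c' i * g i x) with hI
    have hI0 : 0 ≤ I := lp_nonneg _ _ _
    have h3 : l2 c B ≤ R1⁻¹ * I := by
      rw [le_inv_mul_iff₀ hR]; exact h2
    refine ⟨?_, h3⟩
    rcases hI0.eq_or_lt with h0 | h0
    · rw [← h0]; have := dNorm_nonneg ξ p (fun x => ∑ i, c' i * g i x); linarith
    · refine hdisc c' h0 ?_
      rw [hl1]
      have h4 := l1_le_l2 c B (2 * u) (by exact_mod_cast hB)
      calc _ ≤ Real.sqrt (2 * u) * (R1⁻¹ * I) := h4.trans (by gcongr)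
        _ = w * I := by rw [hw]; ring
        _ ≤ 2 ^ J * I := by gcongr

/-! ### Part 5: assembling the proof -/

theorem dNorm_le_sup {X : Type*} {m : ℕ} (hm : 0 < m) (ξ : Fin m → X) (p : ℝ) (hp : 0 < p)
    (F : X → ℂ) (s : ℝ) (hs : 0 ≤ s) (hF : ∀ x, ‖F x‖ ≤ s) : dNorm ξ p F ≤ s := by
  refine (Real.rpow_le_rpow_iff (dNorm_nonneg _ _ _) hs hp).mp ?_
  rw [dNorm_rpow ξ p hp]
  have hmR : (0 : ℝ) < m := by exact_mod_cast hm
  rw [inv_mul_le_iff₀ hmR]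
  calc _ ≤ ∑ j : Fin m, s ^ p :=
        Finset.sum_le_sum fun j _ => Real.rpow_le_rpow (norm_nonneg _) (hF _) hp.le
    _ = _ := by simp

theorem lp_le_one {X : Type*} [MeasurableSpace X] (μ : Measure X) [IsProbabilityMeasure μ]
    (p : ℝ) (hp : 0 < p) (F : X → ℂ) (hF : ∀ x, ‖F x‖ ≤ 1) :
    SamplingRecovery.lpNorm μ p F ≤ 1 := by
  refine (Real.rpow_le_rpow_iff (lp_nonneg _ _ _) zero_le_one hp).mp ?_
  rw [lp_rpow μ p hp, Real.one_rpow]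
  calc _ ≤ ∫ _, (1 : ℝ) ∂μ := by
        refine integral_mono_of_nonneg (Filter.Eventually.of_forall fun x => by positivity)
          (integrable_const _) (Filter.Eventually.of_forall fun x => ?_)
        exact Real.rpow_le_one (norm_nonneg _) (hF x) hp.le
    _ = 1 := by simp

theorem le_sigmaErr {X ι : Type*} (nrm : (X → ℂ) → ℝ) (g : ι → X → ℂ) (v : ℕ) (f : X → ℂ)
    (y C : ℝ) (hC : 0 < C)
    (h : ∀ (B : Finset ι) (c : ι → ℂ), B.card ≤ v →
      y ≤ C * nrm (f - fun x => ∑ i ∈ B, c i * g i x)) : y ≤ C * sigmaErr nrm g v f := by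
  rw [← div_le_iff₀' hC]
  refine le_csInf ?_ ?_
  · exact ⟨_, _, ⟨∅, 0, by simp, rfl⟩, rfl⟩
  · rintro _ ⟨w, ⟨B, c, hB, rfl⟩, rfl⟩
    rw [div_le_iff₀' hC]
    exact h B c hB

/-- the constant `c(t,p)` -/
def cTP (t p : ℝ) : ℝ := 3 + 7 * 72 * 256 * (3 * Real.exp (p + p ^ 2)) / t ^ 2

theorem cTP_ge (t p : ℝ) : 3 ≤ cTP t p := by
  unfold cTP
  have : 0 ≤ 7 * 72 * 256 * (3 * Real.exp (p + p ^ 2)) / t ^ 2 := by positivity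
  linarith

theorem u_facts (t p R1 : ℝ) (ht : 0 < t) (hR : 0 < R1) (hR1 : R1 ≤ 1) (v : ℕ) (hv : 0 < v) :
    4 ≤ uRiesz (cTP t p) R1 v ∧ v ≤ uRiesz (cTP t p) R1 v ∧
    ∃ K : ℕ, 8 * (16 * R1⁻¹) * Real.sqrt v ≤
        Real.exp (t ^ 2 / (72 * (3 * Real.exp (p + p ^ 2)) * (16 * R1⁻¹) ^ 2) * K) ∧
      4 * K * v ≤ uRiesz (cTP t p) R1 v := by
  have hvR : (1 : ℝ) ≤ v := by exact_mod_cast hv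
  set V0 := R1⁻¹ with hV0
  have hV : 1 ≤ V0 := (one_le_inv₀ hR).mpr hR1
  set ℓ := Real.log (2 * V0 * v) with hℓ
  have hVv : 1 ≤ V0 * v := one_le_mul_of_one_le_of_one_le hV hvR
  have hℓ2 : 0.69 ≤ ℓ := by
    have h1 : Real.log 2 ≤ ℓ := Real.log_le_log (by norm_num) (by nlinarith)
    have := Real.log_two_gt_d9
    linarith
  set γ := 3 * Real.exp (p + p ^ 2) with hγ
  have hγ0 : 0 < γ := by positivity
  have hu : (1 + cTP t p * (2 * V0) ^ 2 * ℓ) * (v : ℝ) ≤ uRiesz (cTP t p) R1 v := Nat.le_ceil _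
  set u := uRiesz (cTP t p) R1 v with hudef
  have hV2 : 1 ≤ V0 ^ 2 := one_le_pow₀ hV
  have hV2l : 0.69 ≤ V0 ^ 2 * ℓ := by nlinarith
  have hc3 := cTP_ge t p
  have hcl : 8.28 ≤ cTP t p * (2 * V0) ^ 2 * ℓ := by
    have e : cTP t p * (2 * V0) ^ 2 * ℓ = 4 * (cTP t p * (V0 ^ 2 * ℓ)) := by ring
    rw [e]; nlinarith
  refine ⟨?_, ?_, ?_⟩
  · have : (4 : ℝ) ≤ u := by nlinarith
    exact_mod_cast this
  · have : (v : ℝ) ≤ u := by nlinarith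
    exact_mod_cast this
  · set τ := t ^ 2 / (72 * γ * (16 * V0) ^ 2) with hτ
    have hτ0 : 0 < τ := by positivity
    have hl7 : Real.log (8 * (16 * V0) * Real.sqrt v) ≤ 7 * ℓ := by
      have e : 7 * ℓ = Real.log ((2 * V0 * v) ^ 7) := by rw [Real.log_pow]; norm_num [hℓ]
      rw [e]
      refine Real.log_le_log (by positivity) ?_
      have h1 : Real.sqrt v ≤ v := by
        rw [Real.sqrt_le_left (by positivity)]; nlinarith
      have h2 : V0 * v ≤ (V0 * v) ^ 7 := le_self_pow₀ hVv (by norm_num)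
      have h3 : V0 * Real.sqrt v ≤ V0 * v := by gcongr
      have e2 : (2 * V0 * v) ^ 7 = 128 * (V0 * v) ^ 7 := by ring
      rw [e2]; linarith
    set K := ⌈7 * ℓ / τ⌉₊ with hK
    have hK1 : 7 * ℓ / τ ≤ K := Nat.le_ceil _
    have hK2 : (K : ℝ) ≤ 7 * ℓ / τ + 1 := (Nat.ceil_lt_add_one (by positivity)).le
    refine ⟨K, ?_, ?_⟩
    · rw [← Real.log_le_iff_le_exp (by positivity)]
      refine hl7.trans ?_
      rw [div_le_iff₀ hτ0] at hK1; linarith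
    · have h1 : 4 * (7 * ℓ / τ) + 12 * (V0 ^ 2 * ℓ) = cTP t p * (2 * V0) ^ 2 * ℓ := by
        rw [hτ, cTP, ← hγ]; field_simp; ring
      have h2 : 4 * (K : ℝ) ≤ 1 + cTP t p * (2 * V0) ^ 2 * ℓ := by linarith
      have h3 : 4 * (K : ℝ) * v ≤ u := (mul_le_mul_of_nonneg_right h2 (by linarith)).trans hu
      exact_mod_cast h3

theorem WC.final0 {X ι : Type*} {q : Seminorm ℂ (X → ℂ)} {g : ι → X → ℂ} {t γ V : ℝ}
    {f0 : X → ℂ} {φ : ℕ → ι} {G : ℕ → X → ℂ} {T : Finset ι} {x : ι → ℂ} {v S : ℕ} {ε : ℝ}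
    (H : WC q g t γ V f0 φ G T x v S ε) (K : ℕ)
    (hK : 8 * V * Real.sqrt v ≤ Real.exp (t ^ 2 / (72 * γ * V ^ 2) * K))
    (hS : 4 * K * v + v ≤ S) : q (f0 - G (4 * K * v)) ≤ 3 * ε := by
  have h1 := H.final K hK v 0 ((Finset.card_le_card Finset.sdiff_subset).trans H.hT) (by omega)
  rwa [zero_add] at h1

theorem wcga_disc {X : Type*} {N : ℕ} (g : Fin N → X → ℂ) (p t R1 : ℝ) (hp : 2 < p) (ht : 0 < t)
    (hR : 0 < R1) (hR1 : R1 ≤ 1) (hg : ∀ i x, ‖g i x‖ ≤ 1) {m : ℕ} (hm : 0 < m)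
    (ξ : Fin m → X) (v : ℕ) (hv : 0 < v) (u K : ℕ) (huv : v ≤ u)
    (hK : 8 * (16 * R1⁻¹) * Real.sqrt v ≤
        Real.exp (t ^ 2 / (72 * (3 * Real.exp (p + p ^ 2)) * (16 * R1⁻¹) ^ 2) * K))
    (hKu : 4 * K * v ≤ u)
    (hinc : ∀ (B : Finset (Fin N)) (c : Fin N → ℂ), B.card ≤ 2 * u →
      l2 c B ≤ 16 * R1⁻¹ * dNorm ξ p (fun x => ∑ i ∈ B, c i * g i x))
    (f0 : X → ℂ) (φ : ℕ → Fin N) (G : ℕ → X → ℂ) (hw : IsWCGA g (dNorm ξ p) t f0 φ G)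
    (B : Finset (Fin N)) (c : Fin N → ℂ) (hB : B.card ≤ v) :
    dNorm ξ p (f0 - G u) ≤ 3 * dNorm ξ p (f0 - fun x => ∑ i ∈ B, c i * g i x) := by
  have hp1 : 1 ≤ p := by linarith
  have hsm : ∀ (B : Finset (Fin N)) (c : Fin N → ℂ),
      ∑ i ∈ B, c i • g i = fun x => ∑ i ∈ B, c i * g i x := by
    intro B c; funext x; simp [Finset.sum_apply]
  have hV : 1 ≤ R1⁻¹ := (one_le_inv₀ hR).mpr hR1
  have H : WC (dSemi ξ p hp1) g t (3 * Real.exp (p + p ^ 2)) (16 * R1⁻¹) f0 φ G B c v (2 * u)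
      (dNorm ξ p (f0 - fun x => ∑ i ∈ B, c i * g i x)) :=
    { hγ := by positivity
      hs := fun x y hx => dNorm_smooth ξ p hp x y hx
      hg := fun i => dNorm_le_sup hm ξ p (by linarith) _ 1 zero_le_one (hg i)
      ht := ht
      hV := by linarith
      hw := hw
      hT := hB
      hv := hv
      hε := by rw [hsm]; rfl
      hinc := fun B c hB => by rw [hsm]; exact hinc B c hB }
  have h1 := H.final0 K hK (by omega)
  exact (wc_mono g (dNorm ξ p) t f0 φ G hw hKu).trans h1

theorem diff_rep {X : Type*} {N : ℕ} (g : Fin N → X → ℂ) (nrm : (X → ℂ) → ℝ) (t : ℝ)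
    (f0 : X → ℂ) (φ : ℕ → Fin N) (G : ℕ → X → ℂ) (hw : IsWCGA g nrm t f0 φ G) (u v : ℕ)
    (B : Finset (Fin N)) (c : Fin N → ℂ) (hB : B.card ≤ v) :
    ∃ (B' : Finset (Fin N)) (d : Fin N → ℂ), B'.card ≤ u + v ∧
      (fun x => ∑ i ∈ B, c i * g i x) - G u = fun x => ∑ i ∈ B', d i * g i x := by
  have hG := (wc_best g nrm t f0 φ G hw u).1
  rw [Submodule.mem_span_image_finset_iff_exists_fun'] at hG
  obtain ⟨e, he⟩ := hG
  refine ⟨B ∪ wcT φ u,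
    fun i => (if i ∈ B then c i else 0) - (if i ∈ wcT φ u then e i else 0), ?_, ?_⟩
  · have := Finset.card_union_le B (wcT φ u)
    have := wcT_card φ u
    omega
  · funext x
    rw [← he]
    simp only [Pi.sub_apply, Finset.sum_apply, Pi.smul_apply, smul_eq_mul, sub_mul,
      Finset.sum_sub_distrib, ite_mul, zero_mul]
    congr 1
    · rw [← Finset.sum_filter]; congr 1; ext i; simp +contextual
    · rw [← Finset.sum_filter]; congr 1; ext i; simp +contextual

/-- sampling recovery by the WCGA for uniformly bounded Riesz systems,
`2 < p < ∞`.  There are constants `C0 ≥ 1` (absolute), `c = c(t,p) ≥ 1`, and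
`Cc = C(p,R₁,R₂)` such that whenever `u := ⌈(1 + c(2R₁⁻¹)² ln(2R₁⁻¹ v)) v⌉ ≤ N`, there
exist `m ≤ Cc u^{p/2} (log N)²` points `ξ` for which every realization of the WCGA in
`L_p(Ω_m,μ_m)` satisfies the stated Lebesgue-type inequalities after `u` iterations. -/
theorem wcga_riesz_recovery :
    ∃ C0 : ℝ, 1 ≤ C0 ∧
    ∃ c : ℝ → ℝ → ℝ, (∀ t p, 1 ≤ c t p) ∧
    ∃ Cc : ℝ → ℝ → ℝ → ℝ,
    ∀ p t : ℝ, 2 < p → 0 < t → t ≤ 1 →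
    ∀ R1 R2 : ℝ, 0 < R1 → R1 ≤ R2 →
    ∀ (d : ℕ) (Ω : Set (Fin d → ℝ)), IsCompact Ω →
    ∀ μ : Measure Ω, IsProbabilityMeasure μ →
    ∀ (N : ℕ) (g : Fin N → Ω → ℂ), (∀ i, Continuous (g i)) →
      (∀ i x, ‖g i x‖ ≤ 1) →
      (∀ a : Fin N → ℂ,
        R1 * (∑ j, ‖a j‖ ^ 2) ^ (1 / 2 : ℝ) ≤ lpNorm μ 2 (fun x => ∑ j, a j * g j x) ∧
        lpNorm μ 2 (fun x => ∑ j, a j * g j x) ≤ R2 * (∑ j, ‖a j‖ ^ 2) ^ (1 / 2 : ℝ)) →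
    ∀ v : ℕ, 0 < v → uRiesz (c t p) R1 v ≤ N →
    ∃ (m : ℕ) (ξ : Fin m → Ω),
      (m : ℝ) ≤ Cc p R1 R2 * (uRiesz (c t p) R1 v : ℝ) ^ (p / 2) * (Real.log N) ^ 2 ∧
      ∀ f0 : Ω → ℂ, Continuous f0 →
      ∀ (φ : ℕ → Fin N) (G : ℕ → Ω → ℂ),
        IsWCGA g (dNorm ξ p) t f0 φ G →
        dNorm ξ p (f0 - G (uRiesz (c t p) R1 v)) ≤ C0 * sigmaErr (dNorm ξ p) g v f0 ∧
        lpNorm μ p (f0 - G (uRiesz (c t p) R1 v)) ≤ C0 * sigmaErr supNorm g v f0 := by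
  refine ⟨130, by norm_num, cTP, fun t p => by linarith [cTP_ge t p], fun p R1 _ => CcD p R1, ?_⟩
  intro p t hp ht ht1 R1 R2 hR hR12 d Ω hΩ μ hμ N g hgc hg hz v hv huN
  rcases Nat.eq_zero_or_pos N with hN0 | hN
  · subst hN0
    refine ⟨0, Fin.elim0, by simp, ?_⟩
    intro f0 _ φ
    exact (φ 0).elim0
  have hR1 : R1 ≤ 1 := by
    have h1 := (hz (Pi.single ⟨0, hN⟩ 1)).1
    have e1 : ∑ j, ‖(Pi.single (⟨0, hN⟩ : Fin N) (1 : ℂ) : Fin N → ℂ) j‖ ^ 2 = 1 := by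
      rw [Finset.sum_eq_single (⟨0, hN⟩ : Fin N)]
      · simp
      · intro b _ hb; simp [Pi.single_eq_of_ne hb]
      · simp
    have e2 : (fun x => ∑ j, (Pi.single (⟨0, hN⟩ : Fin N) (1 : ℂ) : Fin N → ℂ) j * g j x)
        = g ⟨0, hN⟩ := by
      funext x
      rw [Finset.sum_eq_single (⟨0, hN⟩ : Fin N)]
      · simp
      · intro b _ hb; simp [Pi.single_eq_of_ne hb]
      · simp
    rw [e1, e2, Real.one_rpow, mul_one] at h1
    exact h1.trans (lp_le_one μ 2 (by norm_num) _ (hg _))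
  obtain ⟨hu4, huv, K, hK, hKu⟩ := u_facts t p R1 ht hR hR1 v hv
  set u := uRiesz (cTP t p) R1 v with hu
  have hgm : ∀ i, Measurable (g i) := fun i => (hgc i).measurable
  have hlog : 1 ≤ Real.log N := by
    have h4 : (4 : ℝ) ≤ N := by exact_mod_cast hu4.trans huN
    rw [Real.le_log_iff_exp_le (by linarith)]
    have := Real.exp_one_lt_d9
    linarith
  obtain ⟨m, ξ, hm, hmb, hdisc⟩ := disc_riesz μ g hgm hg p hp R1 hR hR1 (fun a => (hz a).1) u
    (by omega) huN hlog
  refine ⟨m, ξ, hmb, ?_⟩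
  intro f0 hf0 φ G hw
  have hinc : ∀ (B : Finset (Fin N)) (c : Fin N → ℂ), B.card ≤ 2 * u →
      l2 c B ≤ 16 * R1⁻¹ * dNorm ξ p (fun x => ∑ i ∈ B, c i * g i x) := by
    intro B c hB
    obtain ⟨h1, h2⟩ := hdisc B c hB
    have := mul_le_mul_of_nonneg_left h1 (by positivity : 0 ≤ R1⁻¹)
    linarith
  have hmain := wcga_disc g p t R1 hp ht hR hR1 hg hm ξ v hv u K huv hK hKu hinc f0 φ G hw
  constructor
  · refine le_sigmaErr _ g v f0 _ 130 (by norm_num) fun B c hB => ?_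
    have h0 := dNorm_nonneg ξ p (f0 - fun x => ∑ i ∈ B, c i * g i x)
    have := hmain B c hB
    linarith
  · refine le_sigmaErr _ g v f0 _ 130 (by norm_num) fun B c hB => ?_
    have hcomp : CompactSpace Ω := isCompact_iff_compactSpace.mp hΩ
    set w : Ω → ℂ := fun x => ∑ i ∈ B, c i * g i x with hwdef
    have hwc : Continuous w := continuous_finsetSum _ fun i _ => continuous_const.mul (hgc i)
    have hFc : Continuous (f0 - w) := hf0.sub hwc
    set s := supNorm (f0 - w) with hs
    have hFs : ∀ x, ‖(f0 - w) x‖ ≤ s := fun x =>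
      le_ciSup (f := fun x => ‖(f0 - w) x‖) (isCompact_range hFc.norm).bddAbove x
    have hs0 : 0 ≤ s := Real.iSup_nonneg fun x => norm_nonneg _
    have hds : dNorm ξ p (f0 - w) ≤ s := dNorm_le_sup hm ξ p (by linarith) _ s hs0 hFs
    obtain ⟨B', e, hB', he⟩ := diff_rep g (dNorm ξ p) t f0 φ G hw u v B c hB
    have h16 := (hdisc B' e (by omega)).1
    rw [← he] at h16
    have hdd : dNorm ξ p (w - G u) ≤ 4 * s := by
      have e1 : w - G u = (-1 : ℂ) • (f0 - w) + (f0 - G u) := by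
        rw [neg_smul, one_smul]; abel
      rw [e1]
      refine (dNorm_add_le ξ p (by linarith) _ _).trans ?_
      rw [dNorm_smul ξ p (by linarith), norm_neg, norm_one, one_mul]
      have := hmain B c hB
      linarith
    have hHm : Measurable (w - G u) := by
      rw [he]; exact Finset.measurable_sum _ fun j _ => (hgm _).const_mul _
    have hHb : ∀ x, ‖(w - G u) x‖ ≤ ∑ i ∈ B', ‖e i‖ := by
      intro x
      rw [he]
      refine (norm_sum_le _ _).trans (Finset.sum_le_sum fun i _ => ?_)
      rw [norm_mul]; exact mul_le_of_le_one_right (norm_nonneg _) (hg i x)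
    have hfin := lp_add_sup μ (f0 - w) (w - G u) hHm p hp _ hHb s hs0 hFs
    rw [sub_add_sub_cancel] at hfin
    linarith
end
end
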